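/- For all integers r and k with k ≥ 2r+13 ≥ 18 there exists an integer N_{k,r} such that for every n > N_{k,r}, the maximum number of hyperedges in a connected n-vertex r-uniform hypergraph containing no Berge-path of length k equals C(⌊(k-1)/2⌋, r-1)·(n − ⌊(k-1)/2⌋) + C(⌊(k-1)/2⌋, r) + [k even]·C(⌊(k-1)/2⌋, r-2), where [k even] is 1 if 2 divides k and 0 otherwise and C(a,b) denotes the binomial coefficient. -/

import Mathlib

open scoped Classical

/-- A Berge-path of length `t` in the hypergraph `H` (a family of hyperedges):
an alternating sequence of `t+1` distinct vertices and `t` distinct hyperedges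
`v₁, e₁, …, e_t, v_{t+1}` with `vᵢ, vᵢ₊₁ ∈ eᵢ`. -/
structure BergePath {V : Type*} (H : Finset (Finset V)) (t : ℕ) where
  verts : Fin (t + 1) → V
  edges : Fin t → Finset V
  verts_inj : Function.Injective verts
  edges_inj : Function.Injective edges
  edges_mem : ∀ i, edges i ∈ H
  fst_mem : ∀ i : Fin t, verts i.castSucc ∈ edges i
  snd_mem : ∀ i : Fin t, verts i.succ ∈ edges i

/-- A Berge-cycle of length `t` in the hypergraph `H`: `t` distinct vertices and
`t` distinct hyperedges with `vᵢ, vᵢ₊₁ ∈ eᵢ`, indices mod `t`. -/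
structure BergeCycle {V : Type*} (H : Finset (Finset V)) (t : ℕ) where
  verts : Fin t → V
  edges : Fin t → Finset V
  verts_inj : Function.Injective verts
  edges_inj : Function.Injective edges
  edges_mem : ∀ i, edges i ∈ H
  fst_mem : ∀ i, verts i ∈ edges i
  snd_mem : ∀ i : Fin t, verts ⟨(i.val + 1) % t, Nat.mod_lt _ i.pos⟩ ∈ edges i

/-- `u` and `v` are joined by a Berge-path of `H`. -/
def BergeReachable {V : Type*} (H : Finset (Finset V)) (u v : V) : Prop :=
  ∃ t, ∃ P : BergePath H t, P.verts 0 = u ∧ P.verts (Fin.last t) = v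

/-- A hypergraph on the vertex type `V` is connected if any two vertices are joined
by a Berge-path. -/
def HConnected {V : Type*} (H : Finset (Finset V)) : Prop :=
  ∀ u v : V, u ≠ v → BergeReachable H u v

/-- The degree of a vertex: the number of hyperedges containing it. -/
noncomputable def hdeg {V : Type*} (H : Finset (Finset V)) (v : V) : ℕ :=
  (H.filter (fun e => v ∈ e)).card

/-- The vertex neighborhood of `v` in `H`. -/
noncomputable def nbhd {V : Type*} [Fintype V] (H : Finset (Finset V)) (v : V) : Finset V :=
  Finset.univ.filter (fun u => u ≠ v ∧ ∃ e ∈ H, v ∈ e ∧ u ∈ e)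

/-- The sub-hypergraph induced by a set `S` of vertices: all hyperedges lying inside `S`. -/
noncomputable def restrictTo {V : Type*} (H : Finset (Finset V)) (S : Finset V) :
    Finset (Finset V) :=
  H.filter (fun e => e ⊆ S)

/-- `DelProcess H D S T` : starting from the vertex set `S`, the vertex set `T` can be
reached by repeatedly deleting a vertex whose degree in the current induced
sub-hypergraph is less than `D` (together with all hyperedges containing it). -/
inductive DelProcess {V : Type*} (H : Finset (Finset V)) (D : ℕ) :
    Finset V → Finset V → Prop
  | refl (S : Finset V) : DelProcess H D S S
  | step (S T : Finset V) (v : V) (hv : v ∈ S)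
      (hd : hdeg (restrictTo H S) v < D)
      (h : DelProcess H D (S.erase v) T) : DelProcess H D S T

/-- The edge family of `H_{n,k}` for odd `k`, on vertex set `S` with kernel `A`:
all `r`-subsets of `S` having at most one vertex outside `A`. -/
noncomputable def HnkFamilyOdd {V : Type*} (r : ℕ) (S A : Finset V) : Finset (Finset V) :=
  S.powerset.filter (fun s => s.card = r ∧ (s \ A).card ≤ 1)

/-- The edge family of `H_{n,k}` for even `k`: additionally all `r`-subsets consisting of
`b1`, `b2` and `r-2` vertices of `A`. -/
noncomputable def HnkFamilyEven {V : Type*} (r : ℕ) (S A : Finset V) (b1 b2 : V) :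
    Finset (Finset V) :=
  S.powerset.filter (fun s => s.card = r ∧ ((s \ A).card ≤ 1 ∨ s \ A = {b1, b2}))

/-- `H` is (a copy of) the extremal hypergraph `H_{m,k}` on the vertex set `S`
(where `m = |S|`). Note that `⌊(k-1)/2⌋` equals `(k-1)/2` in ℕ for odd `k`,
and `(k-2)/2` for even `k`. -/
def IsHnkOn {V : Type*} (r k : ℕ) (S : Finset V) (H : Finset (Finset V)) : Prop :=
  ∃ A ⊆ S, A.card = (k - 1) / 2 ∧
    ((Odd k ∧ H = HnkFamilyOdd r S A) ∨
     (Even k ∧ ∃ b1 ∈ S \ A, ∃ b2 ∈ S \ A, b1 ≠ b2 ∧ H = HnkFamilyEven r S A b1 b2))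

/-- The extremal number of hyperedges:
`C(⌊(k-1)/2⌋, r-1)·(n − ⌊(k-1)/2⌋) + C(⌊(k-1)/2⌋, r) + [2 ∣ k]·C(⌊(k-1)/2⌋, r-2)`. -/
def extremalCount (r k n : ℕ) : ℕ :=
  ((k - 1) / 2).choose (r - 1) * (n - (k - 1) / 2) + ((k - 1) / 2).choose r +
    (if 2 ∣ k then ((k - 1) / 2).choose (r - 2) else 0)

/-- The threshold `N_{k,r}`. -/
def Nkr (r k : ℕ) : ℕ :=
  (r * (k - 1)).choose r + ((k - 1) / 2).choose (r - 1) * ((k - 1) / 2)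
    - ((k - 1) / 2).choose r - (if 2 ∣ k then ((k - 1) / 2).choose (r - 2) else 0)
    + r * (k - 1)

/-- `PathOn u w X E`: there is a Berge-path from `u` to `w` whose set of defining vertices
is `X` and whose set of defining hyperedges is `E`. -/
inductive PathOn {V : Type*} : V → V → Finset V → Finset (Finset V) → Prop
  | nil (u : V) : PathOn u u {u} ∅
  | cons {u v w : V} {X : Finset V} {E : Finset (Finset V)} {e : Finset V}
      (h : PathOn v w X E) (hu : u ∉ X) (he : e ∉ E) (hue : u ∈ e) (hve : v ∈ e) :
      PathOn u w (insert u X) (insert e E)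

namespace PathOn

variable {V : Type*} {u v w x y z : V} {X Y : Finset V} {E E' : Finset (Finset V)} {e : Finset V}

theorem left_mem (h : PathOn u w X E) : u ∈ X := by
  cases h <;> simp

theorem right_mem (h : PathOn u w X E) : w ∈ X := by
  induction h with
  | nil => simp
  | cons _ _ _ _ _ ih => exact Finset.mem_insert_of_mem ih

theorem card_eq (h : PathOn u w X E) : X.card = E.card + 1 := by
  induction h with
  | nil => simp
  | cons _ hu he _ _ ih => rw [Finset.card_insert_of_notMem hu, Finset.card_insert_of_notMem he, ih]

theorem glue (h : PathOn u v X E) (h' : PathOn v w Y E') (hXY : X ∩ Y ⊆ {v})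
    (hE : Disjoint E E') : PathOn u w (X ∪ Y) (E ∪ E') := by
  induction h with
  | nil u =>
    have : ({u} : Finset V) ∪ Y = Y := by
      rw [Finset.union_eq_right]; simpa using h'.left_mem
    simpa [this] using h'
  | @cons u v t X E e hp hu he hue hve ih =>
    rw [Finset.insert_union, Finset.insert_union]
    have htX := hp.right_mem
    rw [Finset.disjoint_insert_left] at hE
    refine cons (ih h' ?_ hE.2) ?_ ?_ hue hve
    · exact (Finset.inter_subset_inter_right (Finset.subset_insert _ _)).trans hXY
    · intro hmem
      rcases Finset.mem_union.1 hmem with h1 | h1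
      · exact hu h1
      · have := hXY (Finset.mem_inter.2 ⟨Finset.mem_insert_self _ _, h1⟩)
        rw [Finset.mem_singleton] at this
        exact hu (this ▸ htX)
    · intro hmem
      rcases Finset.mem_union.1 hmem with h1 | h1
      · exact he h1
      · exact hE.1 h1

theorem single (huv : u ≠ v) (hu : u ∈ e) (hv : v ∈ e) : PathOn u v {u, v} {e} := by
  have := cons (nil v) (e := e) (u := u) (by simpa using huv) (by simp) hu hv
  simpa using this

theorem snoc (h : PathOn u v X E) (hw : w ∉ X) (he : e ∉ E) (hv : v ∈ e) (hwe : w ∈ e) :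
    PathOn u w (insert w X) (insert e E) := by
  have hvw : v ≠ w := fun hh => hw (hh ▸ h.right_mem)
  have := h.glue (single hvw hv hwe) (by
    intro a ha
    simp only [Finset.mem_inter, Finset.mem_insert, Finset.mem_singleton] at ha ⊢
    rcases ha with ⟨ha, rfl | rfl⟩
    · rfl
    · exact absurd ha hw) (by simpa using he)
  convert this using 1
  · have := h.right_mem
    ext a; simp only [Finset.mem_insert, Finset.mem_union, Finset.mem_singleton]
    constructor
    · tauto
    · rintro (h1 | rfl | h1) <;> tauto
  · ext a; simp only [Finset.mem_insert, Finset.mem_union, Finset.mem_singleton]; tauto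

theorem symm (h : PathOn u w X E) : PathOn w u X E := by
  induction h with
  | nil u => exact nil u
  | cons _ hu he hue hve ih => exact ih.snoc hu he hve hue

theorem join (h : PathOn u v X E) (h' : PathOn x w Y E') (hXY : Disjoint X Y)
    (hE : Disjoint E E') (he : e ∉ E) (he' : e ∉ E') (hv : v ∈ e) (hx : x ∈ e) :
    PathOn u w (X ∪ Y) (insert e (E ∪ E')) := by
  have h1 := h.glue (h'.cons (u := v) (e := e)
    (fun hh => Finset.disjoint_left.1 hXY h.right_mem hh) he' hv hx) (by
      intro a ha
      simp only [Finset.mem_inter, Finset.mem_insert, Finset.mem_singleton] at ha ⊢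
      rcases ha with ⟨ha, rfl | h2⟩
      · rfl
      · exact absurd h2 (Finset.disjoint_left.1 hXY ha)) (by
      rw [Finset.disjoint_insert_right]; exact ⟨he, hE⟩)
  convert h1 using 1
  · have := h.right_mem
    ext a; simp only [Finset.mem_insert, Finset.mem_union]
    constructor
    · tauto
    · rintro (h1 | rfl | h1) <;> tauto
  · ext a; simp only [Finset.mem_insert, Finset.mem_union]; tauto

theorem exists_pair (h : PathOn u w X E) (he : e ∈ E) :
    ∃ p ∈ X, ∃ q ∈ X, p ≠ q ∧ p ∈ e ∧ q ∈ e := by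
  induction h with
  | nil => simp at he
  | @cons u v w X E f hp hu hf hue hve ih =>
    rcases Finset.mem_insert.1 he with rfl | he
    · refine ⟨u, by simp, v, Finset.mem_insert_of_mem hp.left_mem, ?_, hue, hve⟩
      rintro rfl; exact hu hp.left_mem
    · obtain ⟨p, hp, q, hq, h3⟩ := ih he
      exact ⟨p, Finset.mem_insert_of_mem hp, q, Finset.mem_insert_of_mem hq, h3⟩

theorem split_pred (h : PathOn u w X E) (hx : x ∈ X) (hxu : x ≠ u) :
    ∃ t X₁ E₁ X₂ E₂ e, PathOn u t X₁ E₁ ∧ PathOn x w X₂ E₂ ∧ X = X₁ ∪ X₂ ∧ Disjoint X₁ X₂ ∧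
      E = insert e (E₁ ∪ E₂) ∧ Disjoint E₁ E₂ ∧ e ∉ E₁ ∧ e ∉ E₂ ∧ t ∈ e ∧ x ∈ e := by
  induction h with
  | nil => simp at hx; exact absurd hx hxu
  | @cons u v w X E f hp hu hf hue hve ih =>
    have hxX : x ∈ X := (Finset.mem_insert.1 hx).resolve_left hxu
    by_cases hxv : x = v
    · subst hxv
      refine ⟨u, {u}, ∅, X, E, f, nil u, hp, ?_, ?_, ?_, ?_, ?_, hf, hue, hve⟩
      · ext a; simp
      · simpa using hu
      · simp
      · simp
      · simp
    · obtain ⟨t, X₁, E₁, X₂, E₂, e, h1, h2, rfl, h4, rfl, h6, h7, h8, h9, h10⟩ := ih hxX hxv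
      simp only [Finset.mem_union, Finset.mem_insert, not_or] at hu hf
      refine ⟨t, insert u X₁, insert f E₁, X₂, E₂, e, h1.cons hu.1 hf.2.1 hue hve, h2, ?_, ?_, ?_,
        ?_, ?_, h8, h9, h10⟩
      · rw [Finset.insert_union]
      · rw [Finset.disjoint_insert_left]; exact ⟨hu.2, h4⟩
      · ext a; simp only [Finset.mem_insert, Finset.mem_union]; tauto
      · rw [Finset.disjoint_insert_left]; exact ⟨hf.2.2, h6⟩
      · simp only [Finset.mem_insert, not_or]; exact ⟨fun h => hf.1 h.symm, h7⟩

theorem split_edge (h : PathOn u w X E) (he : e ∈ E) :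
    ∃ t x X₁ E₁ X₂ E₂, PathOn u t X₁ E₁ ∧ PathOn x w X₂ E₂ ∧ X = X₁ ∪ X₂ ∧ Disjoint X₁ X₂ ∧
      E = insert e (E₁ ∪ E₂) ∧ Disjoint E₁ E₂ ∧ e ∉ E₁ ∧ e ∉ E₂ ∧ t ∈ e ∧ x ∈ e := by
  induction h with
  | nil => simp at he
  | @cons u v w X E f hp hu hf hue hve ih =>
    by_cases hef : e = f
    · subst hef
      refine ⟨u, v, {u}, ∅, X, E, nil u, hp, ?_, ?_, ?_, ?_, ?_, hf, hue, hve⟩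
      · ext a; simp
      · simpa using hu
      · simp
      · simp
      · simp
    · obtain ⟨t, x, X₁, E₁, X₂, E₂, h1, h2, rfl, h4, hEE, h6, h7, h8, h9, h10⟩ :=
        ih ((Finset.mem_insert.1 he).resolve_left hef)
      rw [hEE] at hf
      simp only [Finset.mem_union, Finset.mem_insert, not_or] at hu hf
      refine ⟨t, x, insert u X₁, insert f E₁, X₂, E₂, h1.cons hu.1 hf.2.1 hue hve, h2, ?_, ?_, ?_,
        ?_, ?_, h8, h9, h10⟩
      · rw [Finset.insert_union]
      · rw [Finset.disjoint_insert_left]; exact ⟨hu.2, h4⟩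
      · rw [hEE]; ext a; simp only [Finset.mem_insert, Finset.mem_union]; tauto
      · rw [Finset.disjoint_insert_left]; exact ⟨hf.2.2, h6⟩
      · simp only [Finset.mem_insert, not_or]; exact ⟨hef, h7⟩

theorem extend (h : PathOn u w X E) (hx : x ∈ X) (hxe : x ∈ e) (hy : y ∉ X) (hye : y ∈ e) :
    ∃ X' ⊆ insert y X, ∃ E' ⊆ insert e E, PathOn u y X' E' := by
  induction h with
  | nil u =>
    obtain rfl : x = u := by simpa using hx
    have hxy : x ≠ y := by rintro rfl; exact hy (by simp)
    exact ⟨{x, y}, by rw [Finset.pair_comm], {e}, by simp, single hxy hxe hye⟩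
  | @cons u v w X E f hp hu hf hue hve ih =>
    simp only [Finset.mem_insert, not_or] at hy
    by_cases huE : u ∈ e
    · refine ⟨{u, y}, ?_, {e}, by simp, single (Ne.symm hy.1) huE hye⟩
      intro a; simp only [Finset.mem_insert, Finset.mem_singleton]; tauto
    · have hxX : x ∈ X := (Finset.mem_insert.1 hx).resolve_left (by rintro rfl; exact huE hxe)
      obtain ⟨X', hX', E', hE', hP⟩ := ih hxX hy.2
      refine ⟨insert u X', ?_, insert f E', ?_, hP.cons ?_ ?_ hue hve⟩
      · intro a ha
        rcases Finset.mem_insert.1 ha with rfl | ha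
        · simp
        · have := hX' ha
          simp only [Finset.mem_insert] at this ⊢; tauto
      · intro a ha
        rcases Finset.mem_insert.1 ha with rfl | ha
        · simp
        · have := hE' ha
          simp only [Finset.mem_insert] at this ⊢; tauto
      · intro hh
        have := hX' hh
        rw [Finset.mem_insert] at this
        rcases this with h1 | h1
        · exact hy.1 h1.symm
        · exact hu h1
      · intro hh
        have := hE' hh
        rw [Finset.mem_insert] at this
        rcases this with h1 | h1
        · exact huE (h1 ▸ hue)
        · exact hf h1

theorem first_hit (h : PathOn u w X E) {T : Finset V} (hT : ∃ x ∈ X, x ∈ T) :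
    ∃ y ∈ T, ∃ X' ⊆ X, ∃ E' ⊆ E, PathOn u y X' E' ∧ X' ∩ T = {y} := by
  induction h with
  | nil u =>
    obtain ⟨x, hx, hxT⟩ := hT
    obtain rfl : x = u := by simpa using hx
    exact ⟨x, hxT, {x}, by simp, ∅, by simp, nil x, by simpa using hxT⟩
  | @cons u v w X E f hp hu hf hue hve ih =>
    by_cases huT : u ∈ T
    · exact ⟨u, huT, {u}, by simp, ∅, by simp, nil u, by simpa using huT⟩
    · obtain ⟨x, hx, hxT⟩ := hT
      have hxX : x ∈ X := (Finset.mem_insert.1 hx).resolve_left (by rintro rfl; exact huT hxT)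
      obtain ⟨y, hy, X', hX', E', hE', hP, hi⟩ := ih ⟨x, hxX, hxT⟩
      exact ⟨y, hy, insert u X', Finset.insert_subset_insert _ hX', insert f E',
        Finset.insert_subset_insert _ hE',
        hP.cons (fun h => hu (hX' h)) (fun h => hf (hE' h)) hue hve, by
          rw [Finset.insert_inter_of_notMem huT, hi]⟩

/-- A search from `z` inside `U` using the hyperedges `F` reaches `T` unless it is blocked. -/
theorem reach_of_cut {F : Finset (Finset V)} {U T : Finset V}
    (hcut : ∀ S : Finset V, z ∈ S → S ⊆ insert z U → Disjoint S T →
      ∃ e ∈ F, ∃ x ∈ S, ∃ y ∈ U, y ∉ S ∧ x ∈ e ∧ y ∈ e) :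
    ∃ t ∈ T, ∃ X ⊆ insert z U, ∃ E ⊆ F, PathOn z t X E := by
  by_contra! hno
  set S := (insert z U).filter (fun y => ∃ X ⊆ insert z U, ∃ E ⊆ F, PathOn z y X E) with hS
  have hzS : z ∈ S := by
    rw [hS, Finset.mem_filter]
    exact ⟨by simp, {z}, by simp, ∅, by simp, nil z⟩
  obtain ⟨e, he, x, hx, y, hy, hyS, hxe, hye⟩ := hcut S hzS (Finset.filter_subset _ _) (by
    rw [Finset.disjoint_left]
    intro a ha haT
    obtain ⟨_, X, hX, E, hE, hP⟩ := Finset.mem_filter.1 ha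
    exact hno a haT X hX E hE hP)
  obtain ⟨_, X, hX, E, hE, hP⟩ := Finset.mem_filter.1 hx
  apply hyS
  rw [hS, Finset.mem_filter]
  refine ⟨Finset.mem_insert_of_mem hy, ?_⟩
  by_cases hyX : y ∈ X
  · obtain ⟨y', hy', X', hX', E', hE', hP', _⟩ := hP.first_hit (T := {y}) ⟨y, hyX, by simp⟩
    obtain rfl : y' = y := by simpa using hy'
    exact ⟨X', hX'.trans hX, E', hE'.trans hE, hP'⟩
  · obtain ⟨X', hX', E', hE', hP'⟩ := hP.extend hP.right_mem hxe hyX hye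
    exact ⟨X', hX'.trans (Finset.insert_subset (Finset.mem_insert_of_mem hy) hX), E',
      hE'.trans (Finset.insert_subset he hE), hP'⟩

theorem toBergePath {H : Finset (Finset V)} (h : PathOn u w X E) (hE : E ⊆ H) :
    ∃ P : BergePath H E.card, P.verts 0 = u ∧ P.verts (Fin.last _) = w ∧
      (∀ i, P.verts i ∈ X) ∧ ∀ i, P.edges i ∈ E := by
  induction h with
  | nil u =>
    exact ⟨⟨fun _ => u, fun i => i.elim0, fun i j _ => Subsingleton.elim (α := Fin 1) i j,
      fun i => i.elim0, fun i => i.elim0, fun i => i.elim0, fun i => i.elim0⟩, rfl, rfl,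
      by simp, fun i => i.elim0⟩
  | @cons u v w X E f hp hu hf hue hve ih =>
    obtain ⟨P, h0, hl, hX, hEE⟩ := ih ((Finset.subset_insert _ _).trans hE)
    rw [Finset.card_insert_of_notMem hf]
    refine ⟨⟨Fin.cons u P.verts, Fin.cons f P.edges, ?_, ?_, ?_, ?_, ?_⟩, rfl, hl, ?_, ?_⟩
    · rw [Fin.cons_injective_iff]
      refine ⟨?_, P.verts_inj⟩
      rintro ⟨i, hi⟩
      exact hu (hi ▸ hX i)
    · rw [Fin.cons_injective_iff]
      refine ⟨?_, P.edges_inj⟩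
      rintro ⟨i, hi⟩
      exact hf (hi ▸ hEE i)
    · intro i
      refine Fin.cases ?_ (fun i => ?_) i
      · exact hE (Finset.mem_insert_self _ _)
      · exact P.edges_mem i
    · intro i
      refine Fin.cases ?_ (fun i => ?_) i
      · exact hue
      · exact P.fst_mem i
    · intro i
      refine Fin.cases ?_ (fun i => ?_) i
      · simpa [h0] using hve
      · exact P.snd_mem i
    · intro i
      refine Fin.cases ?_ (fun i => ?_) i
      · simp
      · exact Finset.mem_insert_of_mem (hX i)
    · intro i
      refine Fin.cases ?_ (fun i => ?_) i
      · simp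
      · exact Finset.mem_insert_of_mem (hEE i)

theorem bergeReachable {H : Finset (Finset V)} (h : PathOn u w X E) (hE : E ⊆ H) :
    BergeReachable H u w := by
  obtain ⟨P, h0, hl, -⟩ := h.toBergePath hE
  exact ⟨_, P, h0, hl⟩

theorem card_lt {H : Finset (Finset V)} {k : ℕ} (hk : IsEmpty (BergePath H k))
    (h : PathOn u w X E) (hE : E ⊆ H) : E.card < k := by
  by_contra! hle
  obtain ⟨P, -⟩ := h.toBergePath hE
  exact hk.elim ⟨fun i => P.verts (Fin.castLE (by omega) i), fun i => P.edges (Fin.castLE hle i),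
    fun i j hij => by simpa using P.verts_inj hij, fun i j hij => by simpa using P.edges_inj hij,
    fun i => P.edges_mem _, fun i => P.fst_mem _, fun i => P.snd_mem _⟩

end PathOn

theorem HConnected.exists_crossing {V : Type*} {H : Finset (Finset V)} (hH : HConnected H)
    {S : Finset V} {u v : V} (hu : u ∈ S) (hv : v ∉ S) :
    ∃ e ∈ H, ∃ x ∈ S, ∃ y, y ∉ S ∧ x ∈ e ∧ y ∈ e := by
  obtain ⟨t, P, h0, hl⟩ := hH u v (by rintro rfl; exact hv hu)
  by_contra! hno
  have : ∀ i, P.verts i ∈ S := by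
    intro i
    induction i using Fin.induction with
    | zero => exact h0 ▸ hu
    | succ i ih =>
      by_contra hi
      exact hno _ (P.edges_mem i) _ ih _ hi (P.fst_mem i) (P.snd_mem i)
  exact hv (hl ▸ this _)

theorem HConnected.exists_pathOn {V : Type*} [Fintype V] {H : Finset (Finset V)}
    (hH : HConnected H) {S T : Finset V} (hS : S.Nonempty) (hT : T.Nonempty) :
    ∃ x ∈ S, ∃ y ∈ T, ∃ X E, PathOn x y X E ∧ E ⊆ H ∧ X ∩ S ⊆ {x} ∧ X ∩ T ⊆ {y} := by
  obtain ⟨u, hu⟩ := hS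
  obtain ⟨v, hv⟩ := hT
  obtain ⟨t, ht, X, -, E, hE, hP⟩ := PathOn.reach_of_cut (z := u) (F := H) (U := Finset.univ)
    (T := {v}) (by
      intro R hR _ hd
      obtain ⟨e, he, x, hx, y, hy, h1⟩ := hH.exists_crossing hR (v := v) (by simpa using hd)
      exact ⟨e, he, x, hx, y, by simp, hy, h1⟩)
  obtain rfl : t = v := by simpa using ht
  obtain ⟨y, hy, X₁, hX₁, E₁, hE₁, hP₁, hi₁⟩ := hP.first_hit (T := T) ⟨t, hP.right_mem, hv⟩
  obtain ⟨x, hx, X₂, hX₂, E₂, hE₂, hP₂, hi₂⟩ := hP₁.symm.first_hit (T := S) ⟨u, hP₁.left_mem, hu⟩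
  exact ⟨x, hx, y, hy, X₂, E₂, hP₂.symm, hE₂.trans (hE₁.trans hE), hi₂.le,
    (Finset.inter_subset_inter_right hX₂).trans hi₁.le⟩

theorem PathOn.exists_pair_avoiding {V : Type*} {u w : V} {X : Finset V} {E : Finset (Finset V)}
    (h : PathOn u w X E) (T : Finset V) :
    ∃ E' ⊆ E, E'.card + (if u ∈ T then 1 else 0) ≤ 2 * (X ∩ T).card ∧ ∀ e ∈ E, e ∉ E' →
      ∃ p ∈ X, ∃ q ∈ X, p ≠ q ∧ p ∉ T ∧ q ∉ T ∧ p ∈ e ∧ q ∈ e := by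
  induction h with
  | nil u =>
    refine ⟨∅, by simp, ?_, by simp⟩
    by_cases hu : u ∈ T <;> simp [hu]
  | @cons u v w X E f hp hu hf hue hve ih =>
    obtain ⟨E', hE', hc, hpair⟩ := ih
    have huv : u ≠ v := by rintro rfl; exact hu hp.left_mem
    have hcard : (insert u X ∩ T).card = (X ∩ T).card + (if u ∈ T then 1 else 0) := by
      by_cases huT : u ∈ T
      · rw [Finset.insert_inter_of_mem huT, Finset.card_insert_of_notMem (by simp [hu])]
        simp [huT]
      · rw [Finset.insert_inter_of_notMem huT]
        simp [huT]
    have hold : ∀ e ∈ E, e ∉ E' → ∃ p ∈ insert u X, ∃ q ∈ insert u X, p ≠ q ∧ p ∉ T ∧ q ∉ T ∧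
        p ∈ e ∧ q ∈ e := by
      intro e he he'
      obtain ⟨p, hp, q, hq, h3⟩ := hpair e he he'
      exact ⟨p, by simp [hp], q, by simp [hq], h3⟩
    by_cases hT : u ∈ T ∨ v ∈ T
    · refine ⟨insert f E', Finset.insert_subset_insert _ hE', ?_, ?_⟩
      · rw [hcard, Finset.card_insert_of_notMem (fun hh => hf (hE' hh))]
        by_cases huT : u ∈ T
        · simp [huT]; omega
        · have hvT := hT.resolve_left huT
          simp [huT, hvT] at hc ⊢; omega
      · intro e he he'
        simp only [Finset.mem_insert, not_or] at he he'
        exact hold e (he.resolve_left he'.1) he'.2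
    · push Not at hT
      refine ⟨E', hE'.trans (Finset.subset_insert _ _), ?_, ?_⟩
      · rw [hcard]; simp [hT.1, hT.2] at hc ⊢; omega
      · intro e he he'
        rcases Finset.mem_insert.1 he with rfl | he
        · exact ⟨u, by simp, v, by simp [hp.left_mem], huv, hT.1, hT.2, hue, hve⟩
        · exact hold e he he'

theorem PathOn.card_sub_le_two_mul {V : Type*} {u w : V} {X : Finset V} {E : Finset (Finset V)}
    (h : PathOn u w X E) (T : Finset V) :
    ∃ E' ⊆ E, E'.card ≤ 2 * T.card ∧ ∀ e ∈ E, e ∉ E' →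
      ∃ p ∈ X, ∃ q ∈ X, p ≠ q ∧ p ∉ T ∧ q ∉ T ∧ p ∈ e ∧ q ∈ e := by
  obtain ⟨E', h1, h2, h3⟩ := h.exists_pair_avoiding T
  have := Finset.card_le_card (Finset.inter_subset_right : X ∩ T ⊆ T)
  exact ⟨E', h1, by omega, h3⟩

theorem choose_succ_split {a s : ℕ} (ha : 1 ≤ a) (hs : 1 ≤ s) :
    a.choose s = (a - 1).choose s + (a - 1).choose (s - 1) := by
  obtain ⟨b, rfl⟩ := Nat.exists_eq_add_of_le' ha
  obtain ⟨t, rfl⟩ := Nat.exists_eq_add_of_le' hs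
  simp [Nat.choose_succ_succ, add_comm]

theorem add_three_le_choose {n s : ℕ} (hs : 2 ≤ s) (hn : s + 4 ≤ n) : n + 3 ≤ n.choose s := by
  induction s, hs using Nat.le_induction generalizing n with
  | base =>
    obtain ⟨l, rfl⟩ : ∃ l, n = l + 6 := ⟨n - 6, by omega⟩
    rw [Nat.choose_two_right, Nat.le_div_iff_mul_le (by norm_num)]
    have : l + 6 - 1 = l + 5 := by omega
    rw [this]; nlinarith
  | succ s hs ih =>
    obtain ⟨m, rfl⟩ : ∃ m, n = m + 1 := ⟨n - 1, by omega⟩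
    have h1 := ih (n := m) (by omega)
    have h2 : 0 < m.choose (s + 1) := Nat.choose_pos (by omega)
    rw [Nat.choose_succ_succ, Nat.succ_eq_add_one]
    omega

theorem choose_two_add_le {m a : ℕ} (hm : m + 1 ≤ a) :
    m.choose 2 + (a - 1 - m) ≤ (a - 1).choose 2 + 1 := by
  obtain ⟨d, rfl⟩ := Nat.exists_eq_add_of_le hm
  induction d with
  | zero => simp
  | succ d ih =>
    have h := ih (by omega)
    have e1 : m + 1 + (d + 1) - 1 = (m + d) + 1 := by omega
    have e2 : m + 1 + d - 1 = m + d := by omega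
    rw [e2] at h
    rw [e1, Nat.choose_succ_succ (m + d) 1, Nat.choose_one_right]
    rcases Nat.eq_zero_or_pos (m + d) with h0 | h0
    · have h3 : m = 0 := by omega
      have h4 : d = 0 := by omega
      subst h3 h4; simp
    · simp only [Nat.succ_eq_add_one, Nat.reduceAdd] at *
      omega

theorem full_count_of_choose_le {a r q γ β out : ℕ} (hr : 3 ≤ r) (har : r + 6 ≤ a) (hq : 1 ≤ q)
    (hs : q + γ + β ≤ a + 1) (ho : out ≤ q) (ho3 : r = 3 → out ≤ 4)
    (h : a.choose (r - 1) ≤ (q + γ - 1).choose (r - 1) + β + out) : β = 0 ∧ q + γ = a + 1 := by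
  by_contra hne
  have hm : q + γ ≤ a := by omega
  have hsplit := choose_succ_split (a := a) (s := r - 1) (by omega) (by omega)
  rcases Nat.eq_or_lt_of_le hr with h3 | h3
  · obtain rfl : r = 3 := h3.symm
    simp only [Nat.reduceSub, Nat.choose_one_right] at *
    have := choose_two_add_le (m := q + γ - 1) (a := a) (by omega)
    have := ho3 trivial
    omega
  · have h1 := Nat.choose_le_choose (r - 1) (show q + γ - 1 ≤ a - 1 by omega)
    have h2 := add_three_le_choose (n := a - 1) (s := r - 1 - 1) (by omega) (by omega)
    omega

theorem lt_choose_add {a r b : ℕ} (hr : 3 ≤ r) (har : r + 6 ≤ a) (hb : b ≤ a + 1)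
    (hb3 : r = 3 → b ≤ 4) : (a - 1).choose (r - 1) + b < a.choose (r - 1) := by
  have hsplit := choose_succ_split (a := a) (s := r - 1) (by omega) (by omega)
  rcases Nat.eq_or_lt_of_le hr with h3 | h3
  · obtain rfl : r = 3 := h3.symm
    simp only [Nat.reduceSub, Nat.choose_one_right] at *
    have := hb3 trivial
    omega
  · have h2 := add_three_le_choose (n := a - 1) (s := r - 1 - 1) (by omega) (by omega)
    omega

theorem card_filter_mem_subset_le {V : Type*} {F : Finset (Finset V)} {Y : Finset V} {w : V} {r : ℕ}
    (hF : ∀ e ∈ F, e.card = r ∧ w ∈ e ∧ e ⊆ Y) (hw : w ∈ Y) :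
    F.card ≤ (Y.card - 1).choose (r - 1) := by
  rw [← Finset.card_erase_of_mem hw, ← Finset.card_powersetCard]
  refine Finset.card_le_card_of_injOn (fun e => e.erase w) ?_ ?_
  · intro e he
    obtain ⟨h1, h2, h3⟩ := hF e he
    simp only [Finset.mem_coe, Finset.mem_powersetCard]
    exact ⟨Finset.erase_subset_erase _ h3, by rw [Finset.card_erase_of_mem h2, h1]⟩
  · intro e he f hf hef
    rw [← Finset.insert_erase (hF e he).2.1, ← Finset.insert_erase (hF f hf).2.1]
    exact congrArg (insert w) hef

/-- Every nonempty subset of `K` meets more than `D - 1/2` times its size many edges of `F`. -/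
def Hereditary {V : Type*} (F : Finset (Finset V)) (K : Finset V) (D : ℕ) : Prop :=
  ∀ X ⊆ K, X.Nonempty → 2 * D * X.card < 2 * (F.filter (fun e => ∃ v ∈ X, v ∈ e)).card + X.card

theorem Hereditary.degree {V : Type*} {F : Finset (Finset V)} {K : Finset V} {D : ℕ}
    (h : Hereditary F K D) {w : V} (hw : w ∈ K) : D ≤ (F.filter (fun e => w ∈ e)).card := by
  have := h {w} (by simpa using hw) (by simp)
  simp at this
  omega

theorem PathOn.eq_left_of_empty {V : Type*} {u w : V} {X : Finset V}
    (h : PathOn u w X ∅) : u = w := by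
  have h1 := h.card_eq
  simp only [Finset.card_empty, zero_add, Finset.card_eq_one] at h1
  obtain ⟨x, hx⟩ := h1
  have h2 := h.left_mem
  have h3 := h.right_mem
  rw [hx, Finset.mem_singleton] at h2 h3
  rw [h2, h3]

section Rooted

variable {V : Type*} {F Fw : Finset (Finset V)} {K Γ : Finset V} {z : V} {q : ℕ}

/-- There is a path of `F` of length `q` from `z` through `K` with vertex set `X`, ending in `w`. -/
def RootedPath (F : Finset (Finset V)) (K : Finset V) (z : V) (q : ℕ) (w : V) (X : Finset V)
    (E : Finset (Finset V)) : Prop :=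
  w ∈ K ∧ PathOn z w X E ∧ X ⊆ insert z K ∧ E ⊆ F ∧ E.card = q

theorem exists_max_rootedPath (hne : ∃ e ∈ F, z ∈ e ∧ (e ∩ K).Nonempty) (hz : z ∉ K) :
    ∃ q w X E, 1 ≤ q ∧ RootedPath F K z q w X E ∧
      ∀ w' X' E', ¬ RootedPath F K z (q + 1) w' X' E' := by
  obtain ⟨e, he, hze, x, hx⟩ := hne
  rw [Finset.mem_inter] at hx
  have hzx : z ≠ x := fun hh => hz (hh ▸ hx.2)
  let P : ℕ → Prop := fun q => ∃ w X E, RootedPath F K z q w X E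
  have hP1 : P 1 := ⟨x, {z, x}, {e}, hx.2, PathOn.single hzx hze hx.1, by
    intro a ha
    simp only [Finset.mem_insert, Finset.mem_singleton] at ha ⊢
    rcases ha with rfl | rfl
    · exact Or.inl rfl
    · exact Or.inr hx.2, by simpa using he, by simp⟩
  have hb : ∀ q, P q → q ≤ F.card := by
    rintro q ⟨w, X, E, -, -, -, hE, hc⟩
    exact hc ▸ Finset.card_le_card hE
  have h1 := Nat.findGreatest_spec (hb 1 hP1) hP1
  have h2 := Nat.le_findGreatest (hb 1 hP1) hP1
  obtain ⟨w, X, E, h3⟩ := h1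
  refine ⟨_, w, X, E, h2, h3, ?_⟩
  intro w' X' E' h'
  have := Nat.le_findGreatest (P := P) (hb _ ⟨w', X', E', h'⟩) ⟨w', X', E', h'⟩
  omega

theorem RootedPath.subset_of_max {w : V} {X : Finset V} {E : Finset (Finset V)} {e : Finset V}
    (h : RootedPath F K z q w X E) (hmax : ∀ w' X' E', ¬ RootedPath F K z (q + 1) w' X' E')
    (hF : ∀ e ∈ F, e ∉ Fw → e ⊆ K ∪ Γ) (he : e ∈ F) (hw : w ∈ e) (heE : e ∉ E) (heF : e ∉ Fw)
    (hz : z ∉ K) : e ⊆ X.erase z ∪ Γ := by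
  intro y hy
  by_contra hyn
  rw [Finset.mem_union, not_or] at hyn
  have hyK : y ∈ K := (Finset.mem_union.1 (hF e he heF hy)).resolve_right hyn.2
  have hyz : y ≠ z := fun hh => hz (hh ▸ hyK)
  have hyX : y ∉ X := fun hh => hyn.1 (Finset.mem_erase.2 ⟨hyz, hh⟩)
  obtain ⟨-, hp, hX, hE, hc⟩ := h
  refine hmax y (insert y X) (insert e E) ⟨hyK, hp.snoc hyX heE hw hy, ?_, ?_, ?_⟩
  · exact Finset.insert_subset (Finset.mem_insert_of_mem hyK) hX
  · exact Finset.insert_subset he hE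
  · rw [Finset.card_insert_of_notMem heE, hc]

end Rooted

section Rooted

variable {V : Type*} {F Fw : Finset (Finset V)} {K Γ : Finset V} {z w : V} {q a r β : ℕ}
  {X : Finset V} {E : Finset (Finset V)}

theorem RootedPath.left_mem_erase (h : RootedPath F K z q w X E) (hz : z ∉ K) :
    w ∈ X.erase z :=
  Finset.mem_erase.2 ⟨fun hh => hz (hh ▸ h.1), h.2.1.right_mem⟩

theorem RootedPath.card_erase_union (h : RootedPath F K z q w X E) (hKΓ : Disjoint K Γ) :
    (X.erase z ∪ Γ).card = q + Γ.card := by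
  obtain ⟨-, hp, hX, -, hc⟩ := h
  rw [Finset.card_union_of_disjoint, Finset.card_erase_of_mem hp.left_mem, hp.card_eq, hc]
  · simp
  · refine Finset.disjoint_of_subset_left ?_ hKΓ
    intro y hy
    rw [Finset.mem_erase] at hy
    exact (Finset.mem_insert.1 (hX hy.2)).resolve_left hy.1

theorem exists_exceptional_edges {w : V} (hp : PathOn z w X E) (hE : ∀ e ∈ E, e.card = r)
    (T : Finset V) (hwT : w ∈ T) (hT : T.card ≤ 2) :
    ∃ E' ⊆ E, (r = 3 → E'.card ≤ 4) ∧ ∀ e ∈ E, w ∈ e → e ∉ E' → r = 3 →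
      e ⊆ X ∧ ∀ v ∈ T, v ≠ w → v ∉ e := by
  obtain ⟨E', hE', hc, h⟩ := hp.card_sub_le_two_mul T
  refine ⟨E', hE', fun _ => by omega, ?_⟩
  rintro e he hwe heE' rfl
  obtain ⟨p, hp1, q, hq, hpq, hpT, hqT, hpe, hqe⟩ := h e he heE'
  have hpw : p ≠ w := fun hh => hpT (hh ▸ hwT)
  have hqw : q ≠ w := fun hh => hqT (hh ▸ hwT)
  have hsub : ({p, q, w} : Finset V) ⊆ e := by
    intro y hy; simp only [Finset.mem_insert, Finset.mem_singleton] at hy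
    rcases hy with rfl | rfl | rfl <;> assumption
  have heq : ({p, q, w} : Finset V) = e := by
    refine Finset.eq_of_subset_of_card_le hsub ?_
    rw [hE e he, Finset.card_insert_of_notMem (by simp [hpq, hpw]), Finset.card_pair hqw]
  rw [← heq]
  refine ⟨?_, ?_⟩
  · intro y hy; simp only [Finset.mem_insert, Finset.mem_singleton] at hy
    rcases hy with rfl | rfl | rfl
    · assumption
    · assumption
    · exact hp.right_mem
  · intro v hv hvw hve
    simp only [Finset.mem_insert, Finset.mem_singleton] at hve
    rcases hve with rfl | rfl | rfl
    · exact hpT hv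
    · exact hqT hv
    · exact hvw rfl

theorem RootedPath.tight (hr : 3 ≤ r) (har : r + 6 ≤ a) (hu : ∀ e ∈ F, e.card = r)
    (hβ : Fw.card ≤ β) (hF : ∀ e ∈ F, e ∉ Fw → e ⊆ K ∪ Γ)
    (hKΓ : Disjoint K Γ) (hdeg : ∀ v ∈ K, a.choose (r - 1) ≤ (F.filter (fun e => v ∈ e)).card)
    (hz : z ∉ K) (hq : 1 ≤ q) (h : RootedPath F K z q w X E)
    (hmax : ∀ w' X' E', ¬ RootedPath F K z (q + 1) w' X' E') (hs : q + Γ.card + β ≤ a + 1) :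
    β = 0 ∧ q + Γ.card = a + 1 := by
  have hXY : X.erase z ⊆ X.erase z ∪ Γ := Finset.subset_union_left
  have hwY := hXY (h.left_mem_erase hz)
  obtain ⟨E', hE', h3, hE3⟩ := exists_exceptional_edges h.2.1 (fun e he => hu e (h.2.2.2.1 he)) {w}
    (by simp) (by simp)
  set out := E.filter (fun e => w ∈ e ∧ ¬ e ⊆ X.erase z ∪ Γ ∧ e ∉ Fw) with hout
  refine full_count_of_choose_le (out := out.card) hr har hq hs ?_ ?_ ?_
  · exact h.2.2.2.2 ▸ Finset.card_filter_le _ _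
  · intro hr3
    refine (Finset.card_le_card ?_).trans (h3 hr3)
    intro e he
    rw [hout, Finset.mem_filter] at he
    by_contra heE'
    have heX := (hE3 e he.1 he.2.1 heE' hr3).1
    refine he.2.2.1 ?_
    have heK := hF e (h.2.2.2.1 he.1) he.2.2.2
    intro y hy
    rcases Finset.mem_union.1 (heK hy) with hyK | hyK
    · exact Finset.mem_union_left _ (Finset.mem_erase.2 ⟨fun hh => hz (hh ▸ hyK), heX hy⟩)
    · exact Finset.mem_union_right _ hyK
  · refine (hdeg w h.1).trans ?_
    have hsub : F.filter (fun e => w ∈ e) ⊆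
        (F.filter (fun e => w ∈ e ∧ e ⊆ X.erase z ∪ Γ) ∪ Fw) ∪ out := by
      intro e he
      rw [Finset.mem_filter] at he
      simp only [Finset.mem_union, Finset.mem_filter, hout]
      by_cases heF : e ∈ Fw
      · tauto
      by_cases heE : e ∈ E
      · by_cases heY : e ⊆ X.erase z ∪ Γ
        · tauto
        · tauto
      · exact Or.inl (Or.inl ⟨he.1, he.2, h.subset_of_max hmax hF he.1 he.2 heE heF hz⟩)
    have h1 := Finset.card_le_card hsub
    have h2 := Finset.card_union_le (F.filter (fun e => w ∈ e ∧ e ⊆ X.erase z ∪ Γ) ∪ Fw) out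
    have h4 := Finset.card_union_le (F.filter (fun e => w ∈ e ∧ e ⊆ X.erase z ∪ Γ)) Fw
    have h5 := card_filter_mem_subset_le (F := F.filter (fun e => w ∈ e ∧ e ⊆ X.erase z ∪ Γ))
      (r := r) (by
        intro e he
        rw [Finset.mem_filter] at he
        exact ⟨hu e he.1, he.2⟩) hwY
    rw [h.card_erase_union hKΓ] at h5
    omega

theorem RootedPath.exists_chord (hr : 3 ≤ r) (har : r + 6 ≤ a) (hu : ∀ e ∈ F, e.card = r)
    (hF : ∀ e ∈ F, e ⊆ K ∪ Γ) (hKΓ : Disjoint K Γ)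
    (hdeg : ∀ v ∈ K, a.choose (r - 1) ≤ (F.filter (fun e => v ∈ e)).card)
    (hz : z ∈ Γ) (h : RootedPath F K z q w X E)
    (hmax : ∀ w' X' E', ¬ RootedPath F K z (q + 1) w' X' E') (hs : q + Γ.card = a + 1)
    {v : V} (hv : v ∈ X) (hvw : v ≠ w) : ∃ g ∈ F, g ∉ E ∧ v ∈ g ∧ w ∈ g := by
  by_contra! hno
  have hzK : z ∉ K := fun hh => Finset.disjoint_left.1 hKΓ hh hz
  have hwY : w ∈ X.erase z ∪ Γ := Finset.mem_union_left _ (h.left_mem_erase hzK)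
  have hvY : v ∈ X.erase z ∪ Γ := by
    by_cases hvz : v = z
    · exact Finset.mem_union_right _ (hvz.symm ▸ hz)
    · exact Finset.mem_union_left _ (Finset.mem_erase.2 ⟨hvz, hv⟩)
  have hXY : X ⊆ X.erase z ∪ Γ := by
    intro y hy
    by_cases hyz : y = z
    · exact Finset.mem_union_right _ (hyz.symm ▸ hz)
    · exact Finset.mem_union_left _ (Finset.mem_erase.2 ⟨hyz, hy⟩)
  obtain ⟨E', hE', h3, hE3⟩ := exists_exceptional_edges h.2.1 (fun e he => hu e (h.2.2.2.1 he))
    {v, w} (by simp) Finset.card_le_two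
  set bad := E.filter (fun e => w ∈ e ∧ (v ∈ e ∨ ¬ e ⊆ X.erase z ∪ Γ)) with hbad
  have hlt := lt_choose_add (a := a) (r := r) (b := bad.card) hr har (by
    have : bad.card ≤ E.card := Finset.card_filter_le _ _
    have := h.2.2.2.2
    have : 0 < Γ.card := Finset.card_pos.2 ⟨z, hz⟩
    omega) (by
    intro hr3
    refine (Finset.card_le_card ?_).trans (h3 hr3)
    intro e he
    rw [hbad, Finset.mem_filter] at he
    by_contra heE'
    obtain ⟨h4, h5⟩ := hE3 e he.1 he.2.1 heE' hr3
    exact he.2.2.elim (h5 v (by simp) hvw) (fun h6 => h6 (h4.trans hXY)))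
  have hsub : F.filter (fun e => w ∈ e) ⊆
      F.filter (fun e => w ∈ e ∧ e ⊆ (X.erase z ∪ Γ).erase v) ∪ bad := by
    intro e he
    rw [Finset.mem_filter] at he
    simp only [Finset.mem_union, Finset.mem_filter, hbad]
    by_cases heE : e ∈ E
    · by_cases hve : v ∈ e
      · tauto
      by_cases heY : e ⊆ X.erase z ∪ Γ
      · exact Or.inl ⟨he.1, he.2, Finset.subset_erase.2 ⟨heY, hve⟩⟩
      · tauto
    · have hve : v ∉ e := fun hh => hno e he.1 heE hh he.2
      exact Or.inl ⟨he.1, he.2, Finset.subset_erase.2 ⟨h.subset_of_max (Fw := ∅) hmax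
        (fun e he _ => hF e he) he.1 he.2 heE (by simp) hzK, hve⟩⟩
  have h1 := Finset.card_le_card hsub
  have h2 := Finset.card_union_le (F.filter (fun e => w ∈ e ∧ e ⊆ (X.erase z ∪ Γ).erase v)) bad
  have h5 := card_filter_mem_subset_le (r := r) (w := w)
    (F := F.filter (fun e => w ∈ e ∧ e ⊆ (X.erase z ∪ Γ).erase v)) (by
      intro e he
      rw [Finset.mem_filter] at he
      exact ⟨hu e he.1, he.2⟩) (Finset.mem_erase.2 ⟨hvw.symm, hwY⟩)
  rw [Finset.card_erase_of_mem hvY, h.card_erase_union hKΓ, hs] at h5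
  have := hdeg w h.1
  simp only [Nat.add_sub_cancel] at h5
  omega

theorem RootedPath.subset_of_meets (hr : 3 ≤ r) (har : r + 6 ≤ a) (hu : ∀ e ∈ F, e.card = r)
    (hF : ∀ e ∈ F, e ⊆ K ∪ Γ) (hKΓ : Disjoint K Γ)
    (hdeg : ∀ v ∈ K, a.choose (r - 1) ≤ (F.filter (fun e => v ∈ e)).card)
    (hz : z ∈ Γ) (h : RootedPath F K z q w X E)
    (hmax : ∀ w' X' E', ¬ RootedPath F K z (q + 1) w' X' E') (hs : q + Γ.card = a + 1)
    {v : V} (hv : v ∈ X) (hvz : v ≠ z) {e : Finset V} (he : e ∈ F) (hve : v ∈ e) :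
    e ⊆ X.erase z ∪ Γ := by
  have hzK : z ∉ K := fun hh => Finset.disjoint_left.1 hKΓ hh hz
  have hchord := fun v hv hvw => h.exists_chord hr har hu hF hKΓ hdeg hz hmax hs (v := v) hv hvw
  have hXK : ∀ {x}, x ∈ X → x ≠ z → x ∈ K := fun hx hxz =>
    (Finset.mem_insert.1 (h.2.2.1 hx)).resolve_left hxz
  have hfact : ∀ {w' E'}, RootedPath F K z q w' X E' → ∀ e ∈ F, w' ∈ e → e ∉ E' →
      e ⊆ X.erase z ∪ Γ := fun h' e he hw heE =>
    h'.subset_of_max (Fw := ∅) hmax (fun e he _ => hF e he) he hw heE (by simp) hzK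
  have hrot : ∀ {t x X₁ E₁ X₂ E₂ f}, PathOn z t X₁ E₁ → PathOn x w X₂ E₂ → X = X₁ ∪ X₂ →
      Disjoint X₁ X₂ → E = insert f (E₁ ∪ E₂) → Disjoint E₁ E₂ → f ∉ E₁ → f ∉ E₂ →
      ∃ g ∈ F, g ∉ E ∧ w ∈ g ∧ RootedPath F K z q x X (insert g (E₁ ∪ E₂)) := by
    intro t x X₁ E₁ X₂ E₂ f h1 h2 hX hXd hE hEd hf1 hf2
    have htX : t ∈ X := hX ▸ Finset.mem_union_left _ h1.right_mem
    have htw : t ≠ w := fun hh => Finset.disjoint_left.1 hXd h1.right_mem (hh ▸ h2.right_mem)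
    obtain ⟨g, hgF, hgE, htg, hwg⟩ := hchord t htX htw
    have hgE' : g ∉ E₁ ∪ E₂ := fun hh => hgE (hE ▸ Finset.mem_insert_of_mem hh)
    have hfE' : f ∉ E₁ ∪ E₂ := by simp [hf1, hf2]
    have hg2 := hgE'
    rw [Finset.mem_union, not_or] at hg2
    have hxz : x ≠ z := fun hh => Finset.disjoint_left.1 hXd h1.left_mem (hh ▸ h2.left_mem)
    refine ⟨g, hgF, hgE, hwg, hXK (hX ▸ Finset.mem_union_right _ h2.left_mem) hxz,
      hX ▸ h1.join h2.symm hXd hEd hg2.1 hg2.2 htg hwg, h.2.2.1, ?_, ?_⟩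
    · refine Finset.insert_subset hgF (((Finset.subset_insert f _).trans hE.ge).trans h.2.2.2.1)
    · rw [← h.2.2.2.2, hE, Finset.card_insert_of_notMem hgE', Finset.card_insert_of_notMem hfE']
  have hEsub : ∀ e ∈ E, e ⊆ X.erase z ∪ Γ := by
    intro e heE
    obtain ⟨t, x, X₁, E₁, X₂, E₂, h1, h2, hX, hXd, hE, hEd, hf1, hf2, hte, hxe⟩ :=
      h.2.1.split_edge heE
    obtain ⟨g, hgF, hgE, -, hnew⟩ := hrot h1 h2 hX hXd hE hEd hf1 hf2
    refine hfact hnew e (h.2.2.2.1 heE) hxe ?_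
    simp only [Finset.mem_insert, Finset.mem_union, not_or]
    exact ⟨fun hh => hgE (hh ▸ heE), hf1, hf2⟩
  by_cases heE : e ∈ E
  · exact hEsub e heE
  obtain ⟨t, X₁, E₁, X₂, E₂, f, h1, h2, hX, hXd, hE, hEd, hf1, hf2, -, -⟩ :=
    h.2.1.split_pred hv hvz
  obtain ⟨g, hgF, hgE, hwg, hnew⟩ := hrot h1 h2 hX hXd hE hEd hf1 hf2
  by_cases heg : e = g
  · exact heg ▸ hfact h g hgF hwg hgE
  · refine hfact hnew e he hve ?_
    rw [Finset.mem_insert, not_or]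
    exact ⟨heg, fun hh => heE (hE ▸ Finset.mem_insert_of_mem hh)⟩

theorem rooted_dichotomy (hr : 3 ≤ r) (har : r + 6 ≤ a) (hu : ∀ e ∈ F, e.card = r)
    (hβ : Fw.card ≤ β) (hF : ∀ e ∈ F, e ∉ Fw → e ⊆ K ∪ Γ)
    (hKΓ : Disjoint K Γ) (hH : Hereditary F K (a.choose (r - 1))) (hz : z ∉ K)
    (hne : ∃ e ∈ F, z ∈ e ∧ (e ∩ K).Nonempty) :
    (∃ w X E, PathOn z w X E ∧ X ⊆ insert z K ∧ E ⊆ F ∧ 1 ≤ E.card ∧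
      a + 2 ≤ E.card + Γ.card + β) ∨
    (Γ.card = a ∧ β = 0 ∧ ∃ x ∈ K, ∀ R ⊆ Γ, R.card = r - 1 → insert x R ∈ F) := by
  obtain ⟨q, w, X, E, hq, h, hmax⟩ := exists_max_rootedPath hne hz
  by_cases hs : a + 2 ≤ q + Γ.card + β
  · exact Or.inl ⟨w, X, E, h.2.1, h.2.2.1, h.2.2.2.1, by rw [h.2.2.2.2]; exact hq,
      by rw [h.2.2.2.2]; exact hs⟩
  right
  have hdeg : ∀ v ∈ K, a.choose (r - 1) ≤ (F.filter (fun e => v ∈ e)).card :=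
    fun v hv => hH.degree hv
  obtain ⟨rfl, hqa⟩ := h.tight hr har hu hβ hF hKΓ hdeg hz hq hmax (by omega)
  obtain rfl : Fw = ∅ := by simpa using hβ
  replace hF : ∀ e ∈ F, e ⊆ K ∪ Γ := fun e he => hF e he (by simp)
  have hzΓ : z ∈ Γ := by
    obtain ⟨e, he, hze, -⟩ := hne
    exact (Finset.mem_union.1 (hF e he hze)).resolve_left hz
  have hmeet := fun v hv hvz e he hve =>
    h.subset_of_meets hr har hu hF hKΓ hdeg hzΓ hmax hqa (v := v) hv hvz (e := e) he hve
  have hX'K : X.erase z ⊆ K := by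
    intro y hy
    rw [Finset.mem_erase] at hy
    exact (Finset.mem_insert.1 (h.2.2.1 hy.2)).resolve_left hy.1
  have hwX := h.left_mem_erase hz
  have hYc := h.card_erase_union hKΓ
  have hX'c : (X.erase z).card = q := by
    rw [Finset.card_erase_of_mem h.2.1.left_mem, h.2.1.card_eq, h.2.2.2.2]; simp
  have hq1 : q = 1 := by
    by_contra hq1
    have h1 := hH _ hX'K ⟨w, hwX⟩
    have hsub : F.filter (fun e => ∃ v ∈ X.erase z, v ∈ e) ⊆
        F.filter (fun e => w ∈ e ∧ e ⊆ X.erase z ∪ Γ) ∪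
        ((X.erase z).erase w).biUnion
          (fun v => F.filter (fun e => v ∈ e ∧ e ⊆ (X.erase z ∪ Γ).erase w)) := by
      intro e he
      rw [Finset.mem_filter] at he
      obtain ⟨heF, v, hv, hve⟩ := he
      have hv' := Finset.mem_erase.1 hv
      have heY := hmeet v hv'.2 hv'.1 e heF hve
      simp only [Finset.mem_union, Finset.mem_filter, Finset.mem_biUnion]
      by_cases hwe : w ∈ e
      · exact Or.inl ⟨heF, hwe, heY⟩
      · exact Or.inr ⟨v, Finset.mem_erase.2 ⟨fun hh => hwe (hh ▸ hve), hv⟩, heF, hve,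
          Finset.subset_erase.2 ⟨heY, hwe⟩⟩
    have h2 := (Finset.card_le_card hsub).trans (Finset.card_union_le _ _)
    have h3 := card_filter_mem_subset_le (r := r) (w := w) (Y := X.erase z ∪ Γ)
      (F := F.filter (fun e => w ∈ e ∧ e ⊆ X.erase z ∪ Γ)) (by
        intro e he
        rw [Finset.mem_filter] at he
        exact ⟨hu e he.1, he.2⟩) (Finset.mem_union_left _ hwX)
    have h4 := Finset.card_biUnion_le_card_mul ((X.erase z).erase w)
      (fun v => F.filter (fun e => v ∈ e ∧ e ⊆ (X.erase z ∪ Γ).erase w))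
      ((a - 1).choose (r - 1)) (by
        intro v hv
        rw [Finset.mem_erase] at hv
        have h5 := card_filter_mem_subset_le (r := r) (w := v) (Y := (X.erase z ∪ Γ).erase w)
          (F := F.filter (fun e => v ∈ e ∧ e ⊆ (X.erase z ∪ Γ).erase w)) (by
            intro e he
            rw [Finset.mem_filter] at he
            exact ⟨hu e he.1, he.2⟩)
          (Finset.mem_erase.2 ⟨hv.1, Finset.mem_union_left _ hv.2⟩)
        rw [Finset.card_erase_of_mem (Finset.mem_union_left _ hwX), hYc, hqa] at h5
        simpa using h5)
    rw [Finset.card_erase_of_mem hwX, hX'c] at h4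
    rw [hYc, hqa] at h3
    rw [hX'c] at h1
    have hsplit := choose_succ_split (a := a) (s := r - 1) (by omega) (by omega)
    have hpos : 0 < (a - 1).choose (r - 1 - 1) := Nat.choose_pos (by omega)
    obtain ⟨p, rfl⟩ : ∃ p, q = p + 2 := ⟨q - 2, by omega⟩
    simp only [Nat.add_sub_cancel] at h3
    have e1 : p + 2 - 1 = p + 1 := by omega
    rw [e1] at h4
    rw [hsplit] at h1 h3
    nlinarith
  have hΓa : Γ.card = a := by omega
  refine ⟨hΓa, rfl, w, h.1, ?_⟩
  have hX' : X.erase z = {w} := by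
    rw [hq1, Finset.card_eq_one] at hX'c
    obtain ⟨x, hx⟩ := hX'c
    rw [hx, Finset.mem_singleton] at hwX
    rw [hx, hwX]
  have hwΓ : w ∉ Γ := fun hh => Finset.disjoint_left.1 hKΓ h.1 hh
  have hsub : F.filter (fun e => w ∈ e) ⊆ (Γ.powersetCard (r - 1)).image (insert w) := by
    intro e he
    rw [Finset.mem_filter] at he
    have heY := hmeet w (Finset.mem_erase.1 hwX).2 (Finset.mem_erase.1 hwX).1 e he.1 he.2
    rw [hX'] at heY
    rw [Finset.mem_image]
    refine ⟨e.erase w, ?_, Finset.insert_erase he.2⟩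
    rw [Finset.mem_powersetCard, Finset.card_erase_of_mem he.2, hu e he.1]
    refine ⟨?_, rfl⟩
    intro y hy
    rw [Finset.mem_erase] at hy
    have := heY hy.2
    simp only [Finset.mem_union, Finset.mem_singleton] at this
    exact this.resolve_left hy.1
  have heq := Finset.eq_of_subset_of_card_le hsub (by
    refine Finset.card_image_le.trans ?_
    rw [Finset.card_powersetCard, hΓa]
    exact hdeg w h.1)
  intro R hR hRc
  have : insert w R ∈ (Γ.powersetCard (r - 1)).image (insert w) :=
    Finset.mem_image_of_mem _ (Finset.mem_powersetCard.2 ⟨hR, hRc⟩)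
  rw [← heq] at this
  exact (Finset.mem_filter.1 this).1

end Rooted

section Excess

variable {V : Type*}

/-- The edges of `H` meeting `K` and contained in `K ∪ Z`. -/
noncomputable def edgesOn (H : Finset (Finset V)) (Z K : Finset V) : Finset (Finset V) :=
  H.filter (fun e => e ⊆ K ∪ Z ∧ (e ∩ K).Nonempty)

/-- Twice the excess of the number of edges on `K` over `(D - 1/2) |K|`. -/
noncomputable def excess (H : Finset (Finset V)) (Z : Finset V) (D : ℕ) (K : Finset V) : ℤ :=
  2 * (edgesOn H Z K).card - (2 * D - 1) * K.card

/-- No proper nonempty subset of `K` is separated from the rest of `K` by the edges on `K`. -/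
def ConnOn (H : Finset (Finset V)) (Z K : Finset V) : Prop :=
  ∀ X ⊆ K, X.Nonempty → X ≠ K →
    ∃ e ∈ edgesOn H Z K, (∃ x ∈ X, x ∈ e) ∧ ∃ y ∈ K, y ∉ X ∧ y ∈ e

variable {H : Finset (Finset V)} {Z K : Finset V} {D : ℕ}

theorem mem_edgesOn {e : Finset V} :
    e ∈ edgesOn H Z K ↔ e ∈ H ∧ e ⊆ K ∪ Z ∧ (e ∩ K).Nonempty := by
  simp [edgesOn]

theorem excess_empty : excess H Z D ∅ = 0 := by
  simp [excess, edgesOn]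

/-- `𝒫` consists of disjoint connected parts of `K` of positive excess, separated from
the rest of `K`. -/
structure IsDensePartition (H : Finset (Finset V)) (Z : Finset V) (D : ℕ) (K : Finset V)
    (P : Finset (Finset V)) : Prop where
  subset : ∀ Y ∈ P, Y ⊆ K
  nonempty : ∀ Y ∈ P, Y.Nonempty
  conn : ∀ Y ∈ P, ConnOn H Z Y
  excess_pos : ∀ Y ∈ P, 0 < excess H Z D Y
  disjoint : ∀ Y ∈ P, ∀ Y' ∈ P, Y ≠ Y' → Disjoint Y Y'
  separated : ∀ Y ∈ P, ∀ e ∈ edgesOn H Z K, (e ∩ Y).Nonempty → e ⊆ Y ∪ Z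

theorem exists_densePartition (K : Finset V) :
    ∃ P, IsDensePartition H Z D K P ∧ excess H Z D K ≤ ∑ Y ∈ P, excess H Z D Y := by
  induction K using Finset.strongInduction with
  | H K ih =>
    by_cases hpos : excess H Z D K ≤ 0
    · exact ⟨∅, ⟨by simp, by simp, by simp, by simp, by simp, by simp⟩, by simpa using hpos⟩
    push Not at hpos
    have hKne : K.Nonempty := by
      rw [Finset.nonempty_iff_ne_empty]
      rintro rfl
      rw [excess_empty] at hpos
      exact lt_irrefl _ hpos
    by_cases hconn : ConnOn H Z K
    · refine ⟨{K}, ⟨?_, ?_, ?_, ?_, ?_, ?_⟩, by simp⟩ <;>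
        simp only [Finset.mem_singleton, forall_eq]
      · exact subset_rfl
      · exact hKne
      · exact hconn
      · exact hpos
      · intro h; exact absurd rfl h
      · intro e he _; exact (mem_edgesOn.1 he).2.1
    · rw [ConnOn] at hconn
      push Not at hconn
      obtain ⟨X, hXK, hXne, hX, hcross⟩ := hconn
      have hYss : K \ X ⊂ K := Finset.sdiff_ssubset hXK hXne
      have hYne : (K \ X).Nonempty :=
        Finset.sdiff_nonempty.2 fun h => hX (hXK.antisymm h)
      obtain ⟨P, hP, hPs⟩ := ih X (hXK.ssubset_of_ne hX)
      obtain ⟨Q, hQ, hQs⟩ := ih (K \ X) hYss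
      have hdisj : Disjoint X (K \ X) := Finset.disjoint_sdiff
      have hX1 : ∀ e ∈ edgesOn H Z K, (e ∩ X).Nonempty → e ∈ edgesOn H Z X := by
        rintro e he ⟨x, hx⟩
        rw [Finset.mem_inter] at hx
        have he' := mem_edgesOn.1 he
        refine mem_edgesOn.2 ⟨he'.1, ?_, x, Finset.mem_inter.2 hx⟩
        intro y hy
        rcases Finset.mem_union.1 (he'.2.1 hy) with hyK | hyZ
        · by_contra hyn
          simp only [Finset.mem_union, not_or] at hyn
          exact hcross e he ⟨x, hx.2, hx.1⟩ y hyK hyn.1 hy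
        · exact Finset.mem_union_right _ hyZ
      have hY1 : ∀ e ∈ edgesOn H Z K, (e ∩ (K \ X)).Nonempty → e ∈ edgesOn H Z (K \ X) := by
        rintro e he ⟨y, hy⟩
        rw [Finset.mem_inter, Finset.mem_sdiff] at hy
        have he' := mem_edgesOn.1 he
        refine mem_edgesOn.2 ⟨he'.1, ?_, y, by simp [hy]⟩
        intro x hx
        rcases Finset.mem_union.1 (he'.2.1 hx) with hxK | hxZ
        · by_contra hxn
          simp only [Finset.mem_union, Finset.mem_sdiff, not_or, not_and, not_not] at hxn
          exact hcross e he ⟨x, hxn.1 hxK, hx⟩ y hy.2.1 hy.2.2 hy.1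
        · exact Finset.mem_union_right _ hxZ
      have hcov : edgesOn H Z K ⊆ edgesOn H Z X ∪ edgesOn H Z (K \ X) := by
        intro e he
        obtain ⟨y, hy⟩ := (mem_edgesOn.1 he).2.2
        rw [Finset.mem_inter] at hy
        rw [Finset.mem_union]
        by_cases hyX : y ∈ X
        · exact Or.inl (hX1 e he ⟨y, by simp [hy, hyX]⟩)
        · exact Or.inr (hY1 e he ⟨y, by simp [hy, hyX]⟩)
      have hPQ : Disjoint P Q := by
        rw [Finset.disjoint_left]
        intro Y hYP hYQ
        obtain ⟨y, hy⟩ := hP.nonempty Y hYP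
        exact Finset.disjoint_left.1 hdisj (hP.subset Y hYP hy) (hQ.subset Y hYQ hy)
      have hcross' : ∀ Y ∈ P, ∀ Y' ∈ Q, Disjoint Y Y' := fun Y hY Y' hY' =>
        Finset.disjoint_of_subset_left (hP.subset Y hY)
          (Finset.disjoint_of_subset_right (hQ.subset Y' hY') hdisj)
      refine ⟨P ∪ Q, ⟨?_, ?_, ?_, ?_, ?_, ?_⟩, ?_⟩
      · intro Y hY
        rcases Finset.mem_union.1 hY with hY | hY
        · exact (hP.subset Y hY).trans hXK
        · exact (hQ.subset Y hY).trans hYss.1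
      · intro Y hY
        exact (Finset.mem_union.1 hY).elim (hP.nonempty Y) (hQ.nonempty Y)
      · intro Y hY
        exact (Finset.mem_union.1 hY).elim (hP.conn Y) (hQ.conn Y)
      · intro Y hY
        exact (Finset.mem_union.1 hY).elim (hP.excess_pos Y) (hQ.excess_pos Y)
      · intro Y hY Y' hY' hne
        rcases Finset.mem_union.1 hY with hY | hY <;> rcases Finset.mem_union.1 hY' with hY' | hY'
        · exact hP.disjoint Y hY Y' hY' hne
        · exact hcross' Y hY Y' hY'
        · exact (hcross' Y' hY' Y hY).symm
        · exact hQ.disjoint Y hY Y' hY' hne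
      · intro Y hY e he hne
        rcases Finset.mem_union.1 hY with hY | hY
        · exact hP.separated Y hY e
            (hX1 e he (hne.mono (Finset.inter_subset_inter_left (hP.subset Y hY)))) hne
        · exact hQ.separated Y hY e
            (hY1 e he (hne.mono (Finset.inter_subset_inter_left (hQ.subset Y hY)))) hne
      · rw [Finset.sum_union hPQ]
        refine le_trans ?_ (add_le_add hPs hQs)
        have h1 := (Finset.card_le_card hcov).trans (Finset.card_union_le _ _)
        have h2 := Finset.card_sdiff_add_card_eq_card hXK
        simp only [excess]
        have h3 : (K.card : ℤ) = (K \ X).card + X.card := by exact_mod_cast h2.symm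
        have h4 : ((edgesOn H Z K).card : ℤ) ≤ (edgesOn H Z X).card + (edgesOn H Z (K \ X)).card := by
          exact_mod_cast h1
        rw [h3]
        linarith

theorem IsDensePartition.exists_large {P : Finset (Finset V)}
    (hs : excess H Z D K ≤ ∑ Y ∈ P, excess H Z D Y) {B t : ℕ} (hB : P.card < B)
    (ht : (B * t + 1 : ℕ) ≤ excess H Z D K) : ∃ Y ∈ P, (t : ℤ) ≤ excess H Z D Y := by
  by_contra! hno
  have h1 := Finset.sum_le_card_nsmul P (fun Y => excess H Z D Y) t (fun Y hY => (hno Y hY).le)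
  rw [nsmul_eq_mul] at h1
  have h2 : (P.card : ℤ) * t ≤ B * t := by
    have := Nat.mul_le_mul_right t hB.le
    exact_mod_cast this
  push_cast at ht
  linarith

/-- The excess needed to continue the search for `j` more steps. -/
def excessBound (B M : ℕ) : ℕ → ℕ
  | 0 => 1
  | j + 1 => B * excessBound B M j + 1 + 2 * 2 ^ M

theorem excess_le_excess_sdiff_add (hD : 1 ≤ D) (f : Finset V) :
    excess H Z D K ≤ excess H (Z ∪ f) D (K \ f) + 2 * 2 ^ (Z ∪ f).card := by
  have hcov : edgesOn H Z K ⊆ edgesOn H (Z ∪ f) (K \ f) ∪ (Z ∪ f).powerset := by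
    intro e he
    obtain ⟨he, heK, -⟩ := mem_edgesOn.1 he
    rw [Finset.mem_union, Finset.mem_powerset, mem_edgesOn]
    by_cases hne : (e ∩ (K \ f)).Nonempty
    · refine Or.inl ⟨he, ?_, hne⟩
      intro y hy
      have := heK hy
      simp only [Finset.mem_union, Finset.mem_sdiff] at this ⊢
      tauto
    · refine Or.inr ?_
      intro y hy
      have hyK := heK hy
      rw [Finset.not_nonempty_iff_eq_empty, Finset.eq_empty_iff_forall_notMem] at hne
      have := hne y
      simp only [Finset.mem_union, Finset.mem_inter, Finset.mem_sdiff] at *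
      tauto
  have h1 := (Finset.card_le_card hcov).trans (Finset.card_union_le _ _)
  rw [Finset.card_powerset] at h1
  have h2 : ((K \ f).card : ℤ) ≤ K.card := by
    exact_mod_cast Finset.card_le_card Finset.sdiff_subset
  have h3 : ((edgesOn H Z K).card : ℤ) ≤ (edgesOn H (Z ∪ f) (K \ f)).card + 2 ^ (Z ∪ f).card := by
    exact_mod_cast h1
  have h4 : (1 : ℤ) ≤ D := by exact_mod_cast hD
  simp only [excess]
  nlinarith

theorem exists_densePartition_of_path {r k B M : ℕ} (hu : ∀ e ∈ H, e.card = r) (hD : 1 ≤ D)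
    (hk : IsEmpty (BergePath H k)) (hM : r * (k + 1) + 1 ≤ M) {u : V} (j : ℕ) :
    ∀ (Z : Finset V) (z : V) (X : Finset V) (E : Finset (Finset V)) (K f : Finset V),
      E.card + j = k → PathOn u z X E → E ⊆ H → X ⊆ Z → (∀ e ∈ E, e ⊆ Z) → ConnOn H Z K →
      Disjoint K Z → f ∈ edgesOn H Z K → z ∈ f → Z.card ≤ r * E.card + 1 →
      (excessBound B M j : ℤ) ≤ excess H Z D K →
      ∃ Z' : Finset V, Z'.card ≤ M ∧ ∃ P K', Disjoint K' Z' ∧ IsDensePartition H Z' D K' P ∧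
        B ≤ P.card := by
  induction j with
  | zero =>
    intro Z z X E K f hc hp hE
    exact absurd (hp.card_lt hk hE) (by omega)
  | succ j ih =>
    intro Z z X E K f hc hp hE hXZ hEZ hconn hKZ hf hzf hZ hex
    have hf' := mem_edgesOn.1 hf
    have hZ'1 : (Z ∪ f).card ≤ r * (E.card + 1) + 1 := by
      have := Finset.card_union_le Z f
      rw [hu f hf'.1] at this
      rw [mul_add]; omega
    have hZ' : (Z ∪ f).card ≤ M := by
      have : r * (E.card + 1) ≤ r * (k + 1) := Nat.mul_le_mul_left _ (by omega)
      omega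
    have hdisj : Disjoint (K \ f) (Z ∪ f) := by
      rw [Finset.disjoint_union_right]
      exact ⟨Finset.disjoint_of_subset_left Finset.sdiff_subset hKZ, Finset.sdiff_disjoint⟩
    obtain ⟨P, hP, hPs⟩ := exists_densePartition (H := H) (Z := Z ∪ f) (D := D) (K \ f)
    by_cases hB : B ≤ P.card
    · exact ⟨Z ∪ f, hZ', P, K \ f, hdisj, hP, hB⟩
    push Not at hB
    have h1 := excess_le_excess_sdiff_add (H := H) (Z := Z) (K := K) hD f
    have h2 : (2 : ℤ) ^ (Z ∪ f).card ≤ 2 ^ M := pow_le_pow_right₀ (by norm_num) hZ'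
    obtain ⟨Y, hYP, hYex⟩ := IsDensePartition.exists_large (t := excessBound B M j) hPs hB (by
      simp only [excessBound] at hex
      push_cast at hex ⊢
      linarith)
    have hYsub := hP.subset Y hYP
    obtain ⟨x, hx⟩ := hf'.2.2
    rw [Finset.mem_inter] at hx
    have hYK : Y ≠ K := by
      rintro rfl
      exact (Finset.mem_sdiff.1 (hYsub hx.2)).2 hx.1
    obtain ⟨e, he, ⟨p, hpY, hpe⟩, v, hvK, hvY, hve⟩ :=
      hconn Y (hYsub.trans Finset.sdiff_subset) (hP.nonempty Y hYP) hYK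
    have he' := mem_edgesOn.1 he
    have heY : e ⊆ Y ∪ (Z ∪ f) := by
      refine hP.separated Y hYP e (mem_edgesOn.2 ⟨he'.1, ?_, p, ?_⟩) ⟨p, by simp [hpY, hpe]⟩
      · intro y hy
        have := he'.2.1 hy
        simp only [Finset.mem_union, Finset.mem_sdiff] at this ⊢
        tauto
      · exact Finset.mem_inter.2 ⟨hpe, hYsub hpY⟩
    have hvZ : v ∉ Z := fun hh => Finset.disjoint_left.1 hKZ hvK hh
    have hvf : v ∈ f := by
      have := heY hve
      simp only [Finset.mem_union] at this
      tauto
    have hfE : f ∉ E := fun hh => Finset.disjoint_left.1 hKZ hx.2 (hEZ f hh hx.1)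
    have hcard : (insert f E).card = E.card + 1 := Finset.card_insert_of_notMem hfE
    refine ih (Z ∪ f) v (insert v X) (insert f E) Y e (by omega)
      (hp.snoc (fun hh => hvZ (hXZ hh)) hfE hzf hvf) (Finset.insert_subset hf'.1 hE)
      (Finset.insert_subset (Finset.mem_union_right _ hvf) (hXZ.trans Finset.subset_union_left))
      ?_ (hP.conn Y hYP) (Finset.disjoint_of_subset_left hYsub hdisj)
      (mem_edgesOn.2 ⟨he'.1, heY, p, by simp [hpY, hpe]⟩) hve (hcard ▸ hZ'1) hYex
    intro g hg
    rcases Finset.mem_insert.1 hg with rfl | hg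
    · exact Finset.subset_union_right
    · exact (hEZ g hg).trans Finset.subset_union_left

theorem exists_densePartition_card [Fintype V] {r k B M : ℕ} (hu : ∀ e ∈ H, e.card = r)
    (hr : 2 ≤ r) (hD : 1 ≤ D) (hk : IsEmpty (BergePath H k)) (hH : HConnected H)
    (hM : r * (k + 1) + 1 ≤ M) (u : V)
    (hbig : (B * excessBound B M k + 1 : ℕ) + (2 * D - 1) * (Fintype.card V : ℤ) ≤ 2 * H.card) :
    ∃ Z : Finset V, Z.card ≤ M ∧ ∃ P K, Disjoint K Z ∧ IsDensePartition H Z D K P ∧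
      B ≤ P.card := by
  obtain ⟨P, hP, hPs⟩ := exists_densePartition (H := H) (Z := {u}) (D := D) (Finset.univ.erase u)
  have hdisj : Disjoint (Finset.univ.erase u) {u} := by simp
  have hall : ∀ e ∈ H, e ∈ edgesOn H {u} (Finset.univ.erase u) := by
    intro e he
    refine mem_edgesOn.2 ⟨he, ?_, ?_⟩
    · intro y _
      by_cases hy : y = u <;> simp [hy]
    · have : 1 < e.card := by rw [hu e he]; omega
      obtain ⟨y, hy, hyu⟩ := Finset.exists_mem_ne this u
      exact ⟨y, by simp [hy, hyu]⟩
  have hedges : edgesOn H {u} (Finset.univ.erase u) = H :=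
    Finset.Subset.antisymm (Finset.filter_subset _ _) hall
  by_cases hB : B ≤ P.card
  · exact ⟨{u}, by simp; omega, P, _, hdisj, hP, hB⟩
  push Not at hB
  obtain ⟨Y, hYP, hYex⟩ := IsDensePartition.exists_large (t := excessBound B M k) hPs hB (by
    simp only [excess, hedges]
    rw [Finset.card_erase_of_mem (Finset.mem_univ u), Finset.card_univ,
      Nat.cast_sub (Fintype.card_pos_iff.2 ⟨u⟩)]
    have h4 : (1 : ℤ) ≤ D := by exact_mod_cast hD
    push_cast at hbig ⊢
    nlinarith)
  obtain ⟨y, hy⟩ := hP.nonempty Y hYP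
  have huY : u ∉ Y := fun hh => (Finset.mem_erase.1 (hP.subset Y hYP hh)).1 rfl
  obtain ⟨e, he, x, hxY, v, hvY, hxe, hve⟩ := hH.exists_crossing hy huY
  have heY := hP.separated Y hYP e (hall e he) ⟨x, by simp [hxY, hxe]⟩
  have hvu : v = u := by
    have := heY hve
    simp only [Finset.mem_union, Finset.mem_singleton] at this
    tauto
  subst hvu
  refine exists_densePartition_of_path hu hD hk hM k {v} v {v} ∅ Y e (by simp) (PathOn.nil v)
    (by simp) subset_rfl (by simp) (hP.conn Y hYP)
    (Finset.disjoint_of_subset_left (hP.subset Y hYP) hdisj)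
    (mem_edgesOn.2 ⟨he, heY, x, by simp [hxY, hxe]⟩) hve (by simp) hYex

end Excess

section Chunk

variable {V : Type*} {H : Finset (Finset V)} {Z K : Finset V} {D : ℕ}

theorem exists_minimal_excess_pos {Y : Finset V} (hY : 0 < excess H Z D Y) :
    ∃ K ⊆ Y, 0 < excess H Z D K ∧ ∀ K' ⊂ K, excess H Z D K' ≤ 0 := by
  induction Y using Finset.strongInduction with
  | H Y ih =>
    by_cases h : ∀ K' ⊂ Y, excess H Z D K' ≤ 0
    · exact ⟨Y, subset_rfl, hY, h⟩
    · push Not at h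
      obtain ⟨K', hK', hpos⟩ := h
      obtain ⟨K, hK, h2⟩ := ih K' hK' hpos
      exact ⟨K, hK.trans hK'.1, h2⟩

theorem connOn_of_minimal (hK : 0 < excess H Z D K) (hmin : ∀ K' ⊂ K, excess H Z D K' ≤ 0) :
    ConnOn H Z K := by
  obtain ⟨P, hP, hPs⟩ := exists_densePartition (H := H) (Z := Z) (D := D) K
  have hne : P.Nonempty := by
    rw [Finset.nonempty_iff_ne_empty]
    rintro rfl
    simp only [Finset.sum_empty] at hPs
    omega
  obtain ⟨Y, hY⟩ := hne
  have hYK : Y = K := by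
    by_contra hne
    have := hmin Y ((hP.subset Y hY).ssubset_of_ne hne)
    have := hP.excess_pos Y hY
    omega
  exact hYK ▸ hP.conn Y hY

theorem hereditary_of_minimal (hK : 0 < excess H Z D K)
    (hmin : ∀ K' ⊂ K, excess H Z D K' ≤ 0) : Hereditary (edgesOn H Z K) K D := by
  intro X hX hXne
  have h1 := hmin (K \ X) (Finset.sdiff_ssubset hX hXne)
  have hcov : edgesOn H Z K ⊆
      (edgesOn H Z K).filter (fun e => ∃ v ∈ X, v ∈ e) ∪ edgesOn H Z (K \ X) := by
    intro e he
    rw [Finset.mem_union, Finset.mem_filter]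
    by_cases h : ∃ v ∈ X, v ∈ e
    · exact Or.inl ⟨he, h⟩
    · push Not at h
      right
      obtain ⟨he, heK, y, hy⟩ := mem_edgesOn.1 he
      rw [Finset.mem_inter] at hy
      refine mem_edgesOn.2 ⟨he, ?_, y, ?_⟩
      · intro x hx
        have h3 := heK hx
        have h4 := fun hh => h x hh hx
        simp only [Finset.mem_union, Finset.mem_sdiff] at h3 ⊢
        tauto
      · simp only [Finset.mem_inter, Finset.mem_sdiff]
        exact ⟨hy.1, hy.2, fun hh => h y hh hy.1⟩
  have h2 := (Finset.card_le_card hcov).trans (Finset.card_union_le _ _)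
  have h3 := Finset.card_sdiff_add_card_eq_card hX
  have h5 : (K.card : ℤ) = (K \ X).card + X.card := by exact_mod_cast h3.symm
  have h4 : ((edgesOn H Z K).card : ℤ) ≤
      ((edgesOn H Z K).filter (fun e => ∃ v ∈ X, v ∈ e)).card + (edgesOn H Z (K \ X)).card := by
    exact_mod_cast h2
  simp only [excess] at h1 hK
  rw [h5] at hK
  zify
  linarith

/-- The set `A` meets the edges on `K` in distinct representatives, pairwise. -/
def IsAttached (F : Finset (Finset V)) (A : Finset V) : Prop :=
  (∀ z ∈ A, ∃ e ∈ F, z ∈ e) ∧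
    ∀ z ∈ A, ∀ z' ∈ A, z ≠ z' → ∃ e ∈ F, ∃ e' ∈ F, e ≠ e' ∧ z ∈ e ∧ z' ∈ e'

theorem exists_attached {F : Finset (Finset V)} (hF : ∀ e ∈ F, e ⊆ K ∪ Z) :
    ∃ A ⊆ Z, IsAttached F A ∧ ∃ Γ ⊆ A, ∃ Fw : Finset (Finset V), Fw.card ≤ (A \ Γ).card ∧
      ∀ e ∈ F, e ∉ Fw → e ⊆ K ∪ Γ := by
  obtain ⟨A, hA, hmax⟩ := Finset.exists_max_image (Z.powerset.filter (IsAttached F))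
    Finset.card ⟨∅, by simp [IsAttached]⟩
  rw [Finset.mem_filter, Finset.mem_powerset] at hA
  set Γ := A.filter (fun z => 2 ≤ (F.filter (fun e => z ∈ e)).card) with hΓ
  refine ⟨A, hA.1, hA.2, Γ, Finset.filter_subset _ _,
    (A \ Γ).biUnion (fun z => F.filter (fun e => z ∈ e)), ?_, ?_⟩
  · refine (Finset.card_biUnion_le_card_mul _ _ 1 ?_).trans (by simp)
    intro z hz
    rw [hΓ, Finset.mem_sdiff, Finset.mem_filter] at hz
    by_contra hh
    exact hz.2 ⟨hz.1, by omega⟩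
  · intro e he heF y hy
    by_contra hyn
    rw [Finset.mem_union, not_or] at hyn
    have hyZ : y ∈ Z := (Finset.mem_union.1 (hF e he hy)).resolve_left hyn.1
    have hweak : ∀ z ∈ A, z ∉ Γ → z ∉ e := by
      intro z hz hzΓ hze
      refine heF (Finset.mem_biUnion.2 ⟨z, ?_, Finset.mem_filter.2 ⟨he, hze⟩⟩)
      simp [hz, hzΓ]
    have hyA : y ∉ A := fun hh => hweak y hh hyn.2 hy
    have hother : ∀ z ∈ A, ∃ e' ∈ F, e' ≠ e ∧ z ∈ e' := by
      intro z hz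
      by_cases hzΓ : z ∈ Γ
      · rw [hΓ, Finset.mem_filter] at hzΓ
        obtain ⟨e', he', hne⟩ := Finset.exists_mem_ne (show 1 < _ from hzΓ.2) e
        rw [Finset.mem_filter] at he'
        exact ⟨e', he'.1, hne, he'.2⟩
      · obtain ⟨e', he', hze⟩ := hA.2.1 z hz
        exact ⟨e', he', fun hh => hweak z hz hzΓ (hh ▸ hze), hze⟩
    have hins : IsAttached F (insert y A) := by
      refine ⟨?_, ?_⟩
      · intro z hz
        rcases Finset.mem_insert.1 hz with rfl | hz
        · exact ⟨e, he, hy⟩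
        · exact hA.2.1 z hz
      · intro z hz z' hz' hne
        rw [Finset.mem_insert] at hz hz'
        rcases hz with rfl | hzA <;> rcases hz' with rfl | hzA'
        · exact absurd rfl hne
        · obtain ⟨e', he', hne', hze'⟩ := hother z' hzA'
          exact ⟨e, he, e', he', hne'.symm, hy, hze'⟩
        · obtain ⟨e', he', hne', hze'⟩ := hother z hzA
          exact ⟨e', he', e, he, hne', hze', hy⟩
        · exact hA.2.2 z hzA z' hzA' hne
    have := hmax (insert y A) (Finset.mem_filter.2
      ⟨Finset.mem_powerset.2 (Finset.insert_subset hyZ hA.1), hins⟩)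
    rw [Finset.card_insert_of_notMem hyA] at this
    omega

/-- A connected part `K` off `Z`, with hereditarily many edges, attached to `A ⊆ Z`. -/
structure IsChunk (H : Finset (Finset V)) (Z : Finset V) (D : ℕ) (A K : Finset V) : Prop where
  nonempty : K.Nonempty
  disjoint : Disjoint K Z
  conn : ConnOn H Z K
  hered : Hereditary (edgesOn H Z K) K D
  subset : A ⊆ Z
  attached : IsAttached (edgesOn H Z K) A
  weak : ∃ Γ ⊆ A, ∃ Fw : Finset (Finset V), Fw.card ≤ (A \ Γ).card ∧
      ∀ e ∈ edgesOn H Z K, e ∉ Fw → e ⊆ K ∪ Γ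

theorem exists_chunk {Y : Finset V} (hY : 0 < excess H Z D Y) (hYZ : Disjoint Y Z) :
    ∃ K ⊆ Y, ∃ A ⊆ Z, IsChunk H Z D A K := by
  obtain ⟨K, hKY, hK, hmin⟩ := exists_minimal_excess_pos hY
  obtain ⟨A, hAZ, hA, hweak⟩ := exists_attached (F := edgesOn H Z K) (K := K) (Z := Z)
    (fun e he => (mem_edgesOn.1 he).2.1)
  refine ⟨K, hKY, A, hAZ, ?_, Finset.disjoint_of_subset_left hKY hYZ, connOn_of_minimal hK hmin,
    hereditary_of_minimal hK hmin, hAZ, hA, hweak⟩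
  rw [Finset.nonempty_iff_ne_empty]
  rintro rfl
  rw [excess_empty] at hK
  exact lt_irrefl _ hK

theorem disjoint_edgesOn {K K' : Finset V} (hK : Disjoint K K') (hK' : Disjoint K' Z) :
    Disjoint (edgesOn H Z K) (edgesOn H Z K') := by
  rw [Finset.disjoint_left]
  intro e he he'
  obtain ⟨y, hy⟩ := (mem_edgesOn.1 he').2.2
  rw [Finset.mem_inter] at hy
  rcases Finset.mem_union.1 ((mem_edgesOn.1 he).2.1 hy.1) with h | h
  · exact Finset.disjoint_left.1 hK h hy.2
  · exact Finset.disjoint_left.1 hK' hy.2 h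

theorem exists_chunks {P : Finset (Finset V)} {K₀ : Finset V} {b M : ℕ}
    (hP : IsDensePartition H Z D K₀ P) (hdisj : Disjoint K₀ Z) (hM : Z.card ≤ M)
    (hb : 2 ^ M * b ≤ P.card) :
    ∃ A, ∃ Q : Finset (Finset V), b ≤ Q.card ∧ (∀ K ∈ Q, IsChunk H Z D A K) ∧
      ∀ K ∈ Q, ∀ K' ∈ Q, K ≠ K' → Disjoint K K' := by
  have hex : ∀ Y ∈ P, ∃ K ⊆ Y, ∃ A ⊆ Z, IsChunk H Z D A K := fun Y hY =>
    exists_chunk (hP.excess_pos Y hY) (Finset.disjoint_of_subset_left (hP.subset Y hY) hdisj)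
  choose! κ hκ α hα hchunk using hex
  have hcard : Z.powerset.card * b ≤ P.card := by
    rw [Finset.card_powerset]
    exact (Nat.mul_le_mul_right b (Nat.pow_le_pow_right (by norm_num) hM)).trans hb
  obtain ⟨A, -, hA⟩ := Finset.exists_le_card_fiber_of_mul_le_card_of_maps_to (f := α)
    (t := Z.powerset) (s := P) (fun Y hY => Finset.mem_powerset.2 (hα Y hY)) ⟨∅, by simp⟩ hcard
  have hdis : ∀ Y ∈ P, ∀ Y' ∈ P, Y ≠ Y' → Disjoint (κ Y) (κ Y') := fun Y hY Y' hY' hne =>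
    Finset.disjoint_of_subset_left (hκ Y hY)
      (Finset.disjoint_of_subset_right (hκ Y' hY') (hP.disjoint Y hY Y' hY' hne))
  refine ⟨A, (P.filter (fun Y => α Y = A)).image κ, ?_, ?_, ?_⟩
  · rw [Finset.card_image_of_injOn]
    · exact hA
    · intro Y hY Y' hY' heq
      simp only [Finset.coe_filter, Set.mem_ofPred_eq] at hY hY'
      by_contra hne
      obtain ⟨y, hy⟩ := (hchunk Y hY.1).nonempty
      exact Finset.disjoint_left.1 (hdis Y hY.1 Y' hY'.1 hne) hy (heq ▸ hy)
  · intro K hK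
    rw [Finset.mem_image] at hK
    obtain ⟨Y, hY, rfl⟩ := hK
    rw [Finset.mem_filter] at hY
    exact hY.2 ▸ hchunk Y hY.1
  · intro K hK K' hK' hne
    rw [Finset.mem_image] at hK hK'
    obtain ⟨Y, hY, rfl⟩ := hK
    obtain ⟨Y', hY', rfl⟩ := hK'
    rw [Finset.mem_filter] at hY hY'
    exact hdis Y hY.1 Y' hY'.1 (fun hh => hne (by rw [hh]))

theorem IsChunk.exists_pass {A : Finset V} (h : IsChunk H Z D A K) {z z' : V} (hz : z ∈ A)
    (hz' : z' ∈ A) (hne : z ≠ z') :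
    ∃ X E, PathOn z z' X E ∧ X ⊆ insert z (insert z' K) ∧ E ⊆ edgesOn H Z K ∧ 2 ≤ E.card := by
  obtain ⟨e, he, e', he', hee, hze, hze'⟩ := h.attached.2 z hz z' hz' hne
  have hzK : z ∉ K := fun hh => Finset.disjoint_left.1 h.disjoint hh (h.subset hz)
  have hzK' : z' ∉ K := fun hh => Finset.disjoint_left.1 h.disjoint hh (h.subset hz')
  obtain ⟨t, ht, X, hX, E, hE, hp⟩ := PathOn.reach_of_cut (z := z)
    (F := (edgesOn H Z K).erase e') (U := K) (T := e' ∩ K) (by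
      intro S hzS hSK hST
      by_cases hne : (S ∩ K).Nonempty
      · obtain ⟨t, ht⟩ := (mem_edgesOn.1 he').2.2
        obtain ⟨f, hf, ⟨x, hx, hxf⟩, y, hyK, hyS, hyf⟩ :=
          h.conn (S ∩ K) Finset.inter_subset_right hne (by
            intro heq
            have htK := (Finset.mem_inter.1 ht).2
            rw [← heq] at htK
            exact Finset.disjoint_left.1 hST (Finset.mem_inter.1 htK).1 ht)
        rw [Finset.mem_inter] at hx
        refine ⟨f, Finset.mem_erase.2 ⟨?_, hf⟩, x, hx.1, y, hyK, ?_, hxf, hyf⟩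
        · rintro rfl
          exact Finset.disjoint_left.1 hST hx.1 (Finset.mem_inter.2 ⟨hxf, hx.2⟩)
        · intro hh; exact hyS (Finset.mem_inter.2 ⟨hh, hyK⟩)
      · obtain ⟨y, hy⟩ := (mem_edgesOn.1 he).2.2
        rw [Finset.mem_inter] at hy
        refine ⟨e, Finset.mem_erase.2 ⟨hee, he⟩, z, hzS, y, hy.2, ?_, hze, hy.1⟩
        intro hh
        exact hne ⟨y, Finset.mem_inter.2 ⟨hh, hy.2⟩⟩)
  rw [Finset.mem_inter] at ht
  have hz'X : z' ∉ X := fun hh => (Finset.mem_insert.1 (hX hh)).elim (fun h => hne h.symm) hzK'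
  have he'E : e' ∉ E := fun hh => (Finset.mem_erase.1 (hE hh)).1 rfl
  refine ⟨_, _, hp.snoc hz'X he'E ht.1 hze', ?_, ?_, ?_⟩
  · rw [Finset.insert_comm]
    exact Finset.insert_subset_insert _ hX
  · exact Finset.insert_subset he' (hE.trans (Finset.erase_subset _ _))
  · rw [Finset.card_insert_of_notMem he'E]
    have : E.card ≠ 0 := by
      intro h0
      rw [Finset.card_eq_zero] at h0
      subst h0
      exact hzK (hp.eq_left_of_empty ▸ ht.2)
    omega

theorem IsChunk.long_or_core {A : Finset V} {r a : ℕ} (hr : 3 ≤ r) (har : r + 6 ≤ a)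
    (hu : ∀ e ∈ H, e.card = r) (h : IsChunk H Z (a.choose (r - 1)) A K) {z : V} (hz : z ∈ A) :
    (∃ w X E, PathOn z w X E ∧ X ⊆ insert z K ∧ E ⊆ edgesOn H Z K ∧ 1 ≤ E.card ∧
      a + 2 ≤ E.card + A.card) ∨
    (A.card = a ∧ ∃ x ∈ K, ∀ R ⊆ A, R.card = r - 1 → insert x R ∈ H) := by
  obtain ⟨Γ, hΓ, Fw, hFw, hF⟩ := h.weak
  have hKA : Disjoint K A := Finset.disjoint_of_subset_right h.subset h.disjoint
  have hcard := Finset.card_sdiff_add_card_eq_card hΓ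
  obtain ⟨e, he, hze⟩ := h.attached.1 z hz
  rcases rooted_dichotomy (β := (A \ Γ).card) hr har
    (fun e he => hu e (mem_edgesOn.1 he).1) hFw hF (Finset.disjoint_of_subset_right hΓ hKA)
    h.hered (fun hh => Finset.disjoint_left.1 hKA hh hz) ⟨e, he, hze, (mem_edgesOn.1 he).2.2⟩ with
    ⟨w, X, E, h1, h2, h3, h4, h5⟩ | ⟨h1, h2, x, hx, h3⟩
  · exact Or.inl ⟨w, X, E, h1, h2, h3, h4, by omega⟩
  · have hΓA : Γ = A := Finset.eq_of_subset_of_card_le hΓ (by omega)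
    subst hΓA
    exact Or.inr ⟨h1, x, hx, fun R hR hRc => (mem_edgesOn.1 (h3 R hR hRc)).1⟩

theorem IsChunk.exists_long_of_empty {r a : ℕ} (hr : 3 ≤ r) (har : r + 6 ≤ a)
    (hu : ∀ e ∈ H, e.card = r) (h : IsChunk H Z (a.choose (r - 1)) ∅ K) {z : V} (hz : z ∈ K) :
    (∃ w X E, PathOn z w X E ∧ X ⊆ K ∧ E ⊆ edgesOn H Z K ∧ a + 1 ≤ E.card) ∧
      ∀ e ∈ edgesOn H Z K, e ⊆ K := by
  have hF : ∀ e ∈ edgesOn H Z K, e ⊆ K := by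
    obtain ⟨Γ, hΓ, Fw, hFw, hF⟩ := h.weak
    obtain rfl : Γ = ∅ := Finset.subset_empty.1 hΓ
    obtain rfl : Fw = ∅ := by simpa using hFw
    simpa using hF
  refine ⟨?_, hF⟩
  have hD : 1 ≤ a.choose (r - 1) := Nat.choose_pos (by omega)
  have hdeg := hD.trans (h.hered.degree hz)
  obtain ⟨e, he⟩ := Finset.card_pos.1 hdeg
  rw [Finset.mem_filter] at he
  have heK := hF e he.1
  have hec : 1 < e.card := by rw [hu e (mem_edgesOn.1 he.1).1]; omega
  obtain ⟨y, hy, hyz⟩ := Finset.exists_mem_ne hec z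
  rcases rooted_dichotomy (F := edgesOn H Z K) (K := K.erase z) (Γ := {z}) (z := z) (β := 0)
    (Fw := ∅) hr har (fun e he => hu e (mem_edgesOn.1 he).1) (by simp)
    (fun e he _ => by
      intro x hx
      have := hF e he hx
      by_cases hxz : x = z <;> simp [hxz, this]) (by simp)
    (fun X hX hne => h.hered X (hX.trans (Finset.erase_subset _ _)) hne) (by simp)
    ⟨e, he.1, he.2, y, by simp [hy, hyz, heK hy]⟩ with
    ⟨w, X, E, h1, h2, h3, h4, h5⟩ | ⟨h1, -⟩
  · rw [Finset.insert_erase hz] at h2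
    exact ⟨w, X, E, h1, h2, h3, by simp at h5; omega⟩
  · simp at h1; omega

end Chunk

section Pole

variable {V : Type*}

/-- A family of disjoint sets `K ∈ J`, with disjoint edge sets `Φ K`, each of which
carries paths between any two elements of `A`. -/
structure IsPassFamily (A : Finset V) (J : Finset (Finset V))
    (Φ : Finset V → Finset (Finset V)) : Prop where
  disjoint : ∀ K ∈ J, ∀ K' ∈ J, K ≠ K' → Disjoint K K'
  disjoint_edges : ∀ K ∈ J, ∀ K' ∈ J, K ≠ K' → Disjoint (Φ K) (Φ K')
  disjoint_left : ∀ K ∈ J, Disjoint K A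
  pass : ∀ K ∈ J, ∀ z ∈ A, ∀ z' ∈ A, z ≠ z' →
    ∃ X E, PathOn z z' X E ∧ X ⊆ insert z (insert z' K) ∧ E ⊆ Φ K ∧ 2 ≤ E.card

variable {A : Finset V} {J : Finset (Finset V)} {Φ : Finset V → Finset (Finset V)}

theorem IsPassFamily.mono (h : IsPassFamily A J Φ) {J' : Finset (Finset V)} (hJ : J' ⊆ J) :
    IsPassFamily A J' Φ :=
  ⟨fun K hK K' hK' => h.disjoint K (hJ hK) K' (hJ hK'),
    fun K hK K' hK' => h.disjoint_edges K (hJ hK) K' (hJ hK'),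
    fun K hK => h.disjoint_left K (hJ hK), fun K hK => h.pass K (hJ hK)⟩

theorem IsPassFamily.exists_polePath (h : IsPassFamily A J Φ) (n : ℕ) :
    ∀ B ⊆ A, ∀ J' ⊆ J, B.card = n + 1 → n ≤ J'.card → ∀ z ∈ B, ∀ z' ∈ B, (z ≠ z' ∨ B = {z}) →
      ∃ X E, PathOn z z' X E ∧ X ⊆ B ∪ J'.biUnion id ∧ E ⊆ J'.biUnion Φ ∧ 2 * n ≤ E.card := by
  induction n with
  | zero =>
    intro B hB J' hJ' hc _ z hz z' hz' _
    obtain ⟨x, rfl⟩ := Finset.card_eq_one.1 hc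
    obtain rfl : z = x := by simpa using hz
    obtain rfl : z' = z := by simpa using hz'
    exact ⟨{z'}, ∅, PathOn.nil z', by simp, by simp, by simp⟩
  | succ n ih =>
    intro B hB J' hJ' hc hn z hz z' hz' hor
    have hne : z ≠ z' := by
      refine hor.resolve_right fun hh => ?_
      rw [hh] at hc; simp at hc
    have hcB : (B.erase z).card = n + 1 := by rw [Finset.card_erase_of_mem hz, hc]; rfl
    have hz'B : z' ∈ B.erase z := Finset.mem_erase.2 ⟨hne.symm, hz'⟩
    obtain ⟨y, hy, hyor⟩ : ∃ y ∈ B.erase z, y ≠ z' ∨ B.erase z = {y} := by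
      by_cases h1 : B.erase z = {z'}
      · exact ⟨z', hz'B, Or.inr h1⟩
      · by_contra! hno
        exact h1 (Finset.eq_singleton_iff_unique_mem.2 ⟨hz'B, fun x hx => (hno x hx).1⟩)
    obtain ⟨K, hK⟩ : J'.Nonempty := Finset.card_pos.1 (by omega)
    have hy' := Finset.mem_erase.1 hy
    obtain ⟨X₁, E₁, hp₁, hX₁, hE₁, hc₁⟩ :=
      h.pass K (hJ' hK) z (hB hz) y (hB hy'.2) hy'.1.symm
    obtain ⟨X₂, E₂, hp₂, hX₂, hE₂, hc₂⟩ := ih (B.erase z) ((Finset.erase_subset _ _).trans hB)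
      (J'.erase K) ((Finset.erase_subset _ _).trans hJ') hcB
      (by rw [Finset.card_erase_of_mem hK]; omega) y hy z' hz'B hyor
    have hdisE : Disjoint E₁ E₂ := by
      rw [Finset.disjoint_left]
      intro e h1 h2
      obtain ⟨K', hK', h3⟩ := Finset.mem_biUnion.1 (hE₂ h2)
      rw [Finset.mem_erase] at hK'
      exact Finset.disjoint_left.1 (h.disjoint_edges K (hJ' hK) K' (hJ' hK'.2) hK'.1.symm)
        (hE₁ h1) h3
    have hinter : X₁ ∩ X₂ ⊆ {y} := by
      intro x hx
      rw [Finset.mem_inter] at hx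
      rw [Finset.mem_singleton]
      by_contra hxy
      rcases Finset.mem_union.1 (hX₂ hx.2) with h2 | h2
      · rw [Finset.mem_erase] at h2
        have := hX₁ hx.1
        simp only [Finset.mem_insert] at this
        rcases this with h3 | h3 | h3
        · exact h2.1 h3
        · exact hxy h3
        · exact Finset.disjoint_left.1 (h.disjoint_left K (hJ' hK)) h3 (hB h2.2)
      · obtain ⟨K', hK', h4⟩ := Finset.mem_biUnion.1 h2
        rw [Finset.mem_erase] at hK'
        have h5 := h.disjoint_left K' (hJ' hK'.2)
        have := hX₁ hx.1
        simp only [Finset.mem_insert] at this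
        rcases this with h3 | h3 | h3
        · exact Finset.disjoint_left.1 h5 h4 (h3 ▸ hB hz)
        · exact hxy h3
        · exact Finset.disjoint_left.1 (h.disjoint K (hJ' hK) K' (hJ' hK'.2) hK'.1.symm) h3 h4
    refine ⟨X₁ ∪ X₂, E₁ ∪ E₂, hp₁.glue hp₂ hinter hdisE, ?_, ?_, ?_⟩
    · refine Finset.union_subset ?_ ?_
      · intro x hx
        have := hX₁ hx
        simp only [Finset.mem_insert] at this
        rw [Finset.mem_union, Finset.mem_biUnion]
        rcases this with rfl | rfl | h3
        · exact Or.inl hz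
        · exact Or.inl hy'.2
        · exact Or.inr ⟨K, hK, h3⟩
      · refine hX₂.trans (Finset.union_subset_union (Finset.erase_subset _ _) ?_)
        exact Finset.biUnion_subset_biUnion_of_subset_left _ (Finset.erase_subset _ _)
    · refine Finset.union_subset (hE₁.trans (Finset.subset_biUnion_of_mem Φ hK)) (hE₂.trans ?_)
      exact Finset.biUnion_subset_biUnion_of_subset_left _ (Finset.erase_subset _ _)
    · rw [Finset.card_union_of_disjoint hdisE]; omega

theorem IsPassFamily.exists_two_tailed (h : IsPassFamily A J Φ) {z z' w₀ w₁ : V}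
    {X₀ X₁ : Finset V} {E₀ E₁ : Finset (Finset V)} (hJ : A.card ≤ J.card + 1)
    (hz : z ∈ A) (hz' : z' ∈ A) (hor : z ≠ z' ∨ A = {z})
    (hp₀ : PathOn z w₀ X₀ E₀) (hp₁ : PathOn z' w₁ X₁ E₁) (hA₀ : X₀ ∩ A ⊆ {z}) (hA₁ : X₁ ∩ A ⊆ {z'})
    (hX : X₀ ∩ X₁ ⊆ {z'}) (hE : Disjoint E₀ E₁)
    (hX₀ : ∀ K ∈ J, Disjoint X₀ K) (hX₁ : ∀ K ∈ J, Disjoint X₁ K)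
    (hE₀ : ∀ K ∈ J, Disjoint E₀ (Φ K)) (hE₁ : ∀ K ∈ J, Disjoint E₁ (Φ K)) :
    ∃ X E, PathOn w₀ w₁ X E ∧ E ⊆ E₀ ∪ E₁ ∪ J.biUnion Φ ∧
      E₀.card + E₁.card + 2 * (A.card - 1) ≤ E.card := by
  have hApos : 0 < A.card := Finset.card_pos.2 ⟨z, hz⟩
  obtain ⟨Xp, Ep, hp, hXp, hEp, hcp⟩ := h.exists_polePath (A.card - 1) A subset_rfl J subset_rfl
    (by omega) (by omega) z hz z' hz' hor
  have hd₀ : Disjoint E₀ Ep := Finset.disjoint_of_subset_right hEp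
    ((Finset.disjoint_biUnion_right _ _ _).2 hE₀)
  have hd₁ : Disjoint E₁ Ep := Finset.disjoint_of_subset_right hEp
    ((Finset.disjoint_biUnion_right _ _ _).2 hE₁)
  have hi₀ : X₀ ∩ Xp ⊆ {z} := by
    intro x hx
    rw [Finset.mem_inter] at hx
    rcases Finset.mem_union.1 (hXp hx.2) with h1 | h1
    · exact hA₀ (Finset.mem_inter.2 ⟨hx.1, h1⟩)
    · obtain ⟨K, hK, h2⟩ := Finset.mem_biUnion.1 h1
      exact absurd h2 (Finset.disjoint_left.1 (hX₀ K hK) hx.1)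
  have hi₁ : Xp ∩ X₁ ⊆ {z'} := by
    intro x hx
    rw [Finset.mem_inter] at hx
    rcases Finset.mem_union.1 (hXp hx.1) with h1 | h1
    · exact hA₁ (Finset.mem_inter.2 ⟨hx.2, h1⟩)
    · obtain ⟨K, hK, h2⟩ := Finset.mem_biUnion.1 h1
      exact absurd h2 (Finset.disjoint_left.1 (hX₁ K hK) hx.2)
  have hp2 := (hp₀.symm.glue hp hi₀ hd₀).glue hp₁
    (by rw [Finset.union_inter_distrib_right]; exact Finset.union_subset hX hi₁)
    (Finset.disjoint_union_left.2 ⟨hE, hd₁.symm⟩)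
  refine ⟨_, _, hp2, ?_, ?_⟩
  · intro e he
    simp only [Finset.mem_union] at he ⊢
    rcases he with (he | he) | he
    · exact Or.inl (Or.inl he)
    · exact Or.inr (hEp he)
    · exact Or.inl (Or.inr he)
  · rw [Finset.card_union_of_disjoint (Finset.disjoint_union_left.2 ⟨hE, hd₁.symm⟩),
      Finset.card_union_of_disjoint hd₀]
    omega

end Pole

section FindCore

variable {V : Type*} {H : Finset (Finset V)} {Z A : Finset V} {D r a k : ℕ}

theorem isPassFamily_of_chunks {Q : Finset (Finset V)} (hQ : ∀ K ∈ Q, IsChunk H Z D A K)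
    (hdis : ∀ K ∈ Q, ∀ K' ∈ Q, K ≠ K' → Disjoint K K') :
    IsPassFamily A Q (edgesOn H Z) :=
  ⟨hdis, fun K hK K' hK' hne => disjoint_edgesOn (hdis K hK K' hK' hne) (hQ K' hK').disjoint,
    fun K hK => Finset.disjoint_of_subset_right (hQ K hK).subset (hQ K hK).disjoint,
    fun K hK _ hz _ hz' hne => (hQ K hK).exists_pass hz hz' hne⟩

/-- The part `K` carries, from each element of `A`, a path of length at least `a + 2 - |A|`. -/
def IsLong (H : Finset (Finset V)) (Z A : Finset V) (a : ℕ) (K : Finset V) : Prop :=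
  ∀ z ∈ A, ∃ w X E, PathOn z w X E ∧ X ⊆ insert z K ∧ E ⊆ edgesOn H Z K ∧ 1 ≤ E.card ∧
      a + 2 ≤ E.card + A.card

theorem card_long_le (hk : IsEmpty (BergePath H k)) (hka : k ≤ 2 * a + 2)
    {L : Finset (Finset V)} (hL : ∀ K ∈ L, IsChunk H Z D A K ∧ IsLong H Z A a K)
    (hdis : ∀ K ∈ L, ∀ K' ∈ L, K ≠ K' → Disjoint K K') (hA : A.Nonempty) :
    L.card ≤ A.card := by
  by_contra! hlt
  have hApos := hA.card_pos
  obtain ⟨K₀, hK₀, K₁, hK₁, hne⟩ := Finset.one_lt_card.1 (show 1 < L.card by omega)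
  obtain ⟨z, hz, z', hz', hor⟩ : ∃ z ∈ A, ∃ z' ∈ A, z ≠ z' ∨ A = {z} := by
    rcases Nat.eq_or_lt_of_le hApos with h1 | h1
    · obtain ⟨z, hz⟩ := Finset.card_eq_one.1 h1.symm
      exact ⟨z, by simp [hz], z, by simp [hz], Or.inr hz⟩
    · obtain ⟨z, hz, z', hz', hzz⟩ := Finset.one_lt_card.1 h1
      exact ⟨z, hz, z', hz', Or.inl hzz⟩
  obtain ⟨w₀, X₀, E₀, hp₀, hX₀, hE₀, hc₀, hl₀⟩ := (hL K₀ hK₀).2 z hz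
  obtain ⟨w₁, X₁, E₁, hp₁, hX₁, hE₁, hc₁, hl₁⟩ := (hL K₁ hK₁).2 z' hz'
  have hfam := isPassFamily_of_chunks (fun K hK => (hL K hK).1) hdis
  have hJ : (L.erase K₀).erase K₁ ⊆ L := (Finset.erase_subset _ _).trans (Finset.erase_subset _ _)
  have hJm : ∀ K ∈ (L.erase K₀).erase K₁, K ≠ K₁ ∧ K ≠ K₀ ∧ K ∈ L := by
    intro K hK
    simpa only [Finset.mem_erase] using hK
  have hAK : ∀ K ∈ L, ∀ x ∈ A, x ∉ K := fun K hK x hx hh =>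
    Finset.disjoint_left.1 (hfam.disjoint_left K hK) hh hx
  have hAX : ∀ {K y X}, K ∈ L → X ⊆ insert y K → X ∩ A ⊆ {y} := by
    intro K y X hK hX x hx
    rw [Finset.mem_inter] at hx
    rw [Finset.mem_singleton]
    exact (Finset.mem_insert.1 (hX hx.1)).resolve_right (hAK K hK x hx.2)
  have hXK : ∀ {K y X}, K ∈ L → y ∈ A → X ⊆ insert y K → ∀ K' ∈ L, K ≠ K' → Disjoint X K' := by
    intro K y X hK hy hX K' hK' hKK'
    refine Finset.disjoint_of_subset_left hX (Finset.disjoint_insert_left.2 ⟨hAK K' hK' y hy, ?_⟩)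
    exact hdis K hK K' hK' hKK'
  obtain ⟨X, E, hp, hE, hc⟩ := (hfam.mono hJ).exists_two_tailed (by
    rw [Finset.card_erase_of_mem (Finset.mem_erase.2 ⟨hne.symm, hK₁⟩),
      Finset.card_erase_of_mem hK₀]; omega) hz hz' hor hp₀ hp₁ (hAX hK₀ hX₀) (hAX hK₁ hX₁)
    (by
      intro x hx
      rw [Finset.mem_inter] at hx
      rw [Finset.mem_singleton]
      by_contra hxz
      have h1 := (Finset.mem_insert.1 (hX₁ hx.2)).resolve_left hxz
      exact Finset.disjoint_left.1 (hXK hK₀ hz hX₀ K₁ hK₁ hne) hx.1 h1)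
    (Finset.disjoint_of_subset_left hE₀
      (Finset.disjoint_of_subset_right hE₁ (hfam.disjoint_edges K₀ hK₀ K₁ hK₁ hne)))
    (fun K hK => hXK hK₀ hz hX₀ K (hJm K hK).2.2 (hJm K hK).2.1.symm)
    (fun K hK => hXK hK₁ hz' hX₁ K (hJm K hK).2.2 (hJm K hK).1.symm)
    (fun K hK => Finset.disjoint_of_subset_left hE₀
      (hfam.disjoint_edges K₀ hK₀ K (hJm K hK).2.2 (hJm K hK).2.1.symm))
    (fun K hK => Finset.disjoint_of_subset_left hE₁
      (hfam.disjoint_edges K₁ hK₁ K (hJm K hK).2.2 (hJm K hK).1.symm))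
  have hEH : E ⊆ H := by
    intro e he
    have := hE he
    simp only [Finset.mem_union, Finset.mem_biUnion] at this
    rcases this with (h1 | h1) | ⟨K, -, h1⟩
    · exact (mem_edgesOn.1 (hE₀ h1)).1
    · exact (mem_edgesOn.1 (hE₁ h1)).1
    · exact (mem_edgesOn.1 h1).1
  have := hp.card_lt hk hEH
  omega

theorem exists_long_path_of_empty [Fintype V] (hr : 3 ≤ r) (har : r + 6 ≤ a)
    (hu : ∀ e ∈ H, e.card = r) (hH : HConnected H) {K₀ K₁ : Finset V}
    (h₀ : IsChunk H Z (a.choose (r - 1)) ∅ K₀) (h₁ : IsChunk H Z (a.choose (r - 1)) ∅ K₁)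
    (hdis : Disjoint K₀ K₁) :
    ∃ w w' X E, PathOn w w' X E ∧ E ⊆ H ∧ 2 * a + 2 ≤ E.card := by
  obtain ⟨x, hx, y, hy, X, E, hp, hE, hXx, hXy⟩ := hH.exists_pathOn h₀.nonempty h₁.nonempty
  obtain ⟨⟨w₀, X₀, E₀, hp₀, hX₀, hE₀, hc₀⟩, hF₀⟩ := h₀.exists_long_of_empty hr har hu hx
  obtain ⟨⟨w₁, X₁, E₁, hp₁, hX₁, hE₁, hc₁⟩, hF₁⟩ := h₁.exists_long_of_empty hr har hu hy
  have hd : ∀ {K v E'}, X ∩ K ⊆ {v} → E' ⊆ edgesOn H Z K → (∀ e ∈ edgesOn H Z K, e ⊆ K) →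
      Disjoint E' E := by
    intro K v E' hX hE' hF
    rw [Finset.disjoint_left]
    intro e he' he
    obtain ⟨p, hpX, q, hqX, hpq, hpe, hqe⟩ := hp.exists_pair he
    have heK := hF e (hE' he')
    have h1 := hX (Finset.mem_inter.2 ⟨hpX, heK hpe⟩)
    have h2 := hX (Finset.mem_inter.2 ⟨hqX, heK hqe⟩)
    rw [Finset.mem_singleton] at h1 h2
    exact hpq (h1.trans h2.symm)
  have hd0 := hd hXx hE₀ hF₀
  have hd1 := hd hXy hE₁ hF₁
  have hd01 : Disjoint E₀ E₁ := Finset.disjoint_of_subset_left hE₀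
    (Finset.disjoint_of_subset_right hE₁ (disjoint_edgesOn hdis h₁.disjoint))
  have hunion : Disjoint (E₀ ∪ E) E₁ := Finset.disjoint_union_left.2 ⟨hd01, hd1.symm⟩
  refine ⟨w₀, w₁, _, _, (hp₀.symm.glue hp ?_ hd0).glue hp₁ ?_ hunion, ?_, ?_⟩
  · rw [Finset.inter_comm]
    exact (Finset.inter_subset_inter_left hX₀ |>.trans (by rw [Finset.inter_comm])
      |>.trans hXx) |> fun h => by rwa [Finset.inter_comm] at h ⊢
  · rw [Finset.union_inter_distrib_right]
    refine Finset.union_subset ?_ ((Finset.inter_subset_inter_left hX₁).trans hXy)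
    intro v hv
    rw [Finset.mem_inter] at hv
    exact absurd (hX₁ hv.2) (Finset.disjoint_left.1 hdis (hX₀ hv.1))
  · refine Finset.union_subset (Finset.union_subset ?_ hE) ?_
    · exact hE₀.trans (Finset.filter_subset _ _)
    · exact hE₁.trans (Finset.filter_subset _ _)
  · rw [Finset.card_union_of_disjoint hunion, Finset.card_union_of_disjoint hd0]
    omega

/-- Every vertex of `W` forms an edge of `H` with every `(r-1)`-subset of `A`. -/
structure IsCore (H : Finset (Finset V)) (r : ℕ) (A W : Finset V) : Prop where
  disjoint : Disjoint W A
  edge : ∀ w ∈ W, ∀ R ⊆ A, R.card = r - 1 → insert w R ∈ H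

theorem exists_core_of_chunks [Fintype V] (hr : 3 ≤ r) (har : r + 6 ≤ a)
    (hu : ∀ e ∈ H, e.card = r) (hH : HConnected H) (hk : IsEmpty (BergePath H k))
    (hka : k ≤ 2 * a + 2) {Q : Finset (Finset V)} {b : ℕ}
    (hQ : ∀ K ∈ Q, IsChunk H Z (a.choose (r - 1)) A K)
    (hdis : ∀ K ∈ Q, ∀ K' ∈ Q, K ≠ K' → Disjoint K K') (hb : Z.card + b + 2 ≤ Q.card) :
    ∃ A W : Finset V, A.card = a ∧ b ≤ W.card ∧ IsCore H r A W := by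
  rcases A.eq_empty_or_nonempty with rfl | hA
  · obtain ⟨K₀, hK₀, K₁, hK₁, hne⟩ := Finset.one_lt_card.1 (show 1 < Q.card by omega)
    obtain ⟨w, w', X, E, hp, hE, hc⟩ :=
      exists_long_path_of_empty hr har hu hH (hQ K₀ hK₀) (hQ K₁ hK₁) (hdis K₀ hK₀ K₁ hK₁ hne)
    exact absurd (hp.card_lt hk hE) (by omega)
  have hlong := card_long_le (L := Q.filter (IsLong H Z A a)) hk hka
    (fun K hK => ⟨hQ K (Finset.mem_filter.1 hK).1, (Finset.mem_filter.1 hK).2⟩)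
    (fun K hK K' hK' => hdis K (Finset.mem_filter.1 hK).1 K' (Finset.mem_filter.1 hK').1) hA
  have hsum := Finset.card_filter_add_card_filter_not (s := Q) (IsLong H Z A a)
  have hcore : ∀ K ∈ Q.filter (fun K => ¬ IsLong H Z A a K), K ∈ Q ∧ A.card = a ∧
      ∃ x ∈ K, ∀ R ⊆ A, R.card = r - 1 → insert x R ∈ H := by
    intro K hK
    rw [Finset.mem_filter] at hK
    refine ⟨hK.1, ?_⟩
    by_contra hno
    exact hK.2 fun z hz => ((hQ K hK.1).long_or_core hr har hu hz).resolve_right hno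
  have hAZ : A.card ≤ Z.card := by
    obtain ⟨K, hK⟩ := Finset.card_pos.1 (show 0 < Q.card by omega)
    exact Finset.card_le_card (hQ K hK).subset
  obtain ⟨K, hK⟩ := Finset.card_pos.1
    (show 0 < (Q.filter (fun K => ¬ IsLong H Z A a K)).card by omega)
  have hex : ∀ K ∈ Q.filter (fun K => ¬ IsLong H Z A a K),
      ∃ x ∈ K, ∀ R ⊆ A, R.card = r - 1 → insert x R ∈ H := fun K hK => (hcore K hK).2.2
  have : Nonempty V := ⟨(hex K hK).choose⟩
  choose! x hxK hx using hex
  refine ⟨A, (Q.filter (fun K => ¬ IsLong H Z A a K)).image x, (hcore K hK).2.1, ?_, ?_, ?_⟩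
  · rw [Finset.card_image_of_injOn]
    · omega
    · intro K hK K' hK' heq
      by_contra hne
      exact Finset.disjoint_left.1 (hdis K (hcore K hK).1 K' (hcore K' hK').1 hne) (hxK K hK)
        (heq ▸ hxK K' hK')
  · rw [Finset.disjoint_left]
    intro w hw hwA
    obtain ⟨K, hK, rfl⟩ := Finset.mem_image.1 hw
    have h := hQ K (hcore K hK).1
    exact Finset.disjoint_left.1 h.disjoint (hxK K hK) (h.subset hwA)
  · intro w hw R hR hRc
    obtain ⟨K, hK, rfl⟩ := Finset.mem_image.1 hw
    exact hx K hK R hR hRc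

theorem exists_core [Fintype V] (hr : 3 ≤ r) (har : r + 6 ≤ a)
    (hu : ∀ e ∈ H, e.card = r) (hH : HConnected H) (hk : IsEmpty (BergePath H k))
    (hka : k ≤ 2 * a + 2) {b M B : ℕ} (hM : r * (k + 1) + 1 ≤ M) (hB : 2 ^ M * (M + b + 2) ≤ B)
    (u : V) (hbig : (B * excessBound B M k + 1 : ℕ) +
      (2 * a.choose (r - 1) - 1) * (Fintype.card V : ℤ) ≤ 2 * H.card) :
    ∃ A W : Finset V, A.card = a ∧ b ≤ W.card ∧ IsCore H r A W := by
  obtain ⟨Z, hZ, P, K, hKZ, hP, hPc⟩ := exists_densePartition_card hu (by omega)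
    (Nat.choose_pos (by omega)) hk hH hM u hbig
  obtain ⟨A, Q, hQc, hQ, hdis⟩ := exists_chunks hP hKZ hZ (hB.trans hPc)
  exact exists_core_of_chunks hr har hu hH hk hka hQ hdis (by omega)

end FindCore

section Tail

variable {V : Type*} {H : Finset (Finset V)} {A : Finset V} {z z' w v : V} {X X₀ X₁ : Finset V}
  {E E₀ E₁ : Finset (Finset V)} {e : Finset V} {r k a L : ℕ}

/-- A Berge-path of `H` starting at `z ∈ A` and otherwise avoiding `A`. -/
structure IsTail (H : Finset (Finset V)) (A : Finset V) (z w : V) (X : Finset V)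
    (E : Finset (Finset V)) : Prop where
  mem : z ∈ A
  path : PathOn z w X E
  inter : X ∩ A ⊆ {z}
  subset : E ⊆ H

theorem IsTail.snoc (h : IsTail H A z w X E) (hv : v ∉ X) (hvA : v ∉ A) (he : e ∉ E) (heH : e ∈ H)
    (hw : w ∈ e) (hve : v ∈ e) : IsTail H A z v (insert v X) (insert e E) where
  mem := h.mem
  path := h.path.snoc hv he hw hve
  inter := by rw [Finset.insert_inter_of_notMem hvA]; exact h.inter
  subset := Finset.insert_subset heH h.subset

theorem IsTail.single (hz : z ∈ A) (hv : v ∉ A) (he : e ∈ H) (hze : z ∈ e) (hve : v ∈ e) :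
    IsTail H A z v {z, v} {e} where
  mem := hz
  path := PathOn.single (fun h => hv (h ▸ hz)) hze hve
  inter := by
    intro x hx
    simp only [Finset.mem_inter, Finset.mem_insert, Finset.mem_singleton] at hx ⊢
    rcases hx with ⟨rfl | rfl, hx⟩
    · rfl
    · exact absurd hx hv
  subset := by simpa using he

theorem exists_isTail [Fintype V] (hH : HConnected H) (hA : A.Nonempty) (v : V) :
    ∃ z X E, IsTail H A z v X E := by
  obtain ⟨z, hz, y, hy, X, E, hp, hE, hX, -⟩ :=
    hH.exists_pathOn hA (Finset.singleton_nonempty v)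
  rw [Finset.mem_singleton] at hy
  exact ⟨z, X, E, hz, hy ▸ hp, hX, hE⟩

theorem IsTail.card_pos (h : IsTail H A z v X E) (hv : v ∉ A) : 0 < E.card := by
  rw [Finset.card_pos, Finset.nonempty_iff_ne_empty]
  rintro rfl
  exact hv (h.path.eq_left_of_empty ▸ h.mem)

theorem PathOn.eq_of_card_eq_one {u w : V} (h : PathOn u w X E) (hE : E.card = 1) :
    ∃ e, E = {e} ∧ u ∈ e ∧ w ∈ e ∧ X = {u, w} := by
  cases h with
  | nil => simp at hE
  | @cons _ v _ X E e h hu he hue hve =>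
    rw [Finset.card_insert_of_notMem he] at hE
    obtain rfl := Finset.card_eq_zero.1 (by omega : E.card = 0)
    have hp := h.card_eq
    rw [Finset.card_empty, Finset.card_eq_one] at hp
    obtain ⟨x, rfl⟩ := hp
    have h1 := Finset.mem_singleton.1 h.left_mem
    have h2 := Finset.mem_singleton.1 h.right_mem
    subst h1 h2
    exact ⟨e, by simp, hue, hve, rfl⟩

/-- The edges of `H` whose part outside `A` is `K`. -/
noncomputable def edgesOver (H : Finset (Finset V)) (A K : Finset V) : Finset (Finset V) :=
  H.filter (fun e => e \ A = K)

theorem IsCore.exists_edge {W : Finset V} (h : IsCore H r A W) (hr : 2 ≤ r) (har : r ≤ A.card)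
    (hw : w ∈ W) (hz : z ∈ A) (hz' : z' ∈ A) (hzz : z ≠ z') :
    ∃ e ∈ edgesOver H A {w}, w ∈ e ∧ z ∈ e ∧ z' ∉ e := by
  have hwA := Finset.disjoint_left.1 h.disjoint hw
  obtain ⟨R, hzR, hR, hRc⟩ := Finset.exists_subsuperset_card_eq (s := {z}) (t := A.erase z')
    (n := r - 1) (by simpa using ⟨hzz, hz⟩) (by simp; omega)
    (by have := Finset.pred_card_le_card_erase (s := A) (a := z'); omega)
  have hRA : R ⊆ A := hR.trans (Finset.erase_subset _ _)
  refine ⟨insert w R, ?_, Finset.mem_insert_self _ _, Finset.mem_insert_of_mem (hzR (by simp)), ?_⟩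
  · rw [edgesOver, Finset.mem_filter]
    refine ⟨h.edge w hw R hRA hRc, ?_⟩
    rw [Finset.insert_sdiff_of_notMem _ hwA, Finset.sdiff_eq_empty_iff_subset.2 hRA]
    rfl
  · rw [Finset.mem_insert]
    rintro (h1 | h1)
    · exact hwA (h1 ▸ hz')
    · exact Finset.notMem_erase _ _ (hR h1)

theorem IsCore.isPassFamily {W W' : Finset V} (h : IsCore H r A W) (hr : 2 ≤ r)
    (har : r ≤ A.card) (hW : W' ⊆ W) :
    IsPassFamily A (W'.image fun w => {w}) (edgesOver H A) where
  disjoint := by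
    intro K hK K' hK' hne
    obtain ⟨w, hw, rfl⟩ := Finset.mem_image.1 hK
    obtain ⟨w', hw', rfl⟩ := Finset.mem_image.1 hK'
    rw [Finset.disjoint_singleton]
    exact fun hh => hne (by rw [hh])
  disjoint_edges := by
    intro K hK K' hK' hne
    rw [Finset.disjoint_left]
    intro e he he'
    exact hne ((Finset.mem_filter.1 he).2.symm.trans (Finset.mem_filter.1 he').2)
  disjoint_left := by
    intro K hK
    obtain ⟨w, hw, rfl⟩ := Finset.mem_image.1 hK
    rw [Finset.disjoint_singleton_left]
    exact Finset.disjoint_left.1 h.disjoint (hW hw)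
  pass := by
    intro K hK z hz z' hz' hzz
    obtain ⟨w, hw, rfl⟩ := Finset.mem_image.1 hK
    have hwA := Finset.disjoint_left.1 h.disjoint (hW hw)
    obtain ⟨e, he, hwe, hze, hz'e⟩ := h.exists_edge hr har (hW hw) hz hz' hzz
    obtain ⟨e', he', hwe', hze', hz'e'⟩ := h.exists_edge hr har (hW hw) hz' hz hzz.symm
    have hne : e' ≠ e := fun hh => hz'e (hh ▸ hze')
    have hwz : z ≠ w := fun hh => hwA (hh ▸ hz)
    have hwz' : z' ≠ w := fun hh => hwA (hh ▸ hz')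
    refine ⟨_, _, (PathOn.single hwz hze hwe).snoc (w := z') (e := e') (by simpa using ⟨hzz.symm, hwz'⟩)
      (by simpa using hne) hwe' hze', ?_, ?_, ?_⟩
    · intro x hx
      simp only [Finset.mem_insert, Finset.mem_singleton] at hx ⊢
      tauto
    · intro f hf
      simp only [Finset.mem_insert, Finset.mem_singleton] at hf
      rcases hf with rfl | rfl <;> assumption
    · rw [Finset.card_pair hne]

theorem IsCore.tails_card_lt {W : Finset V} (h : IsCore H r A W) (hr : 2 ≤ r)
    (har : r ≤ A.card) (hu : ∀ e ∈ H, e.card = r) (hk : IsEmpty (BergePath H k))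
    (hW : 2 * k + r * (2 * k) + A.card ≤ W.card) {w₀ w₁ : V} (h₀ : IsTail H A z w₀ X₀ E₀)
    (h₁ : IsTail H A z' w₁ X₁ E₁) (hX : Disjoint X₀ X₁) (hE : Disjoint E₀ E₁) :
    E₀.card + E₁.card + 2 * (A.card - 1) < k := by
  have hc₀ := h₀.path.card_lt hk h₀.subset
  have hc₁ := h₁.path.card_lt hk h₁.subset
  have hX₀ := h₀.path.card_eq
  have hX₁ := h₁.path.card_eq
  have hEc : ((E₀ ∪ E₁).biUnion id).card ≤ r * (2 * k) := by
    refine (Finset.card_biUnion_le_card_mul _ _ r fun e he => ?_).trans ?_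
    · rcases Finset.mem_union.1 he with he | he
      · exact (hu e (h₀.subset he)).le
      · exact (hu e (h₁.subset he)).le
    · rw [mul_comm]
      exact Nat.mul_le_mul_left _ ((Finset.card_union_le _ _).trans (by omega))
  have hUc := Finset.card_union_le (X₀ ∪ X₁) ((E₀ ∪ E₁).biUnion id)
  have hXc := Finset.card_union_le X₀ X₁
  have hW' := Finset.le_card_sdiff (X₀ ∪ X₁ ∪ (E₀ ∪ E₁).biUnion id) W
  set W' := W \ (X₀ ∪ X₁ ∪ (E₀ ∪ E₁).biUnion id) with hW'def
  have hout : ∀ w ∈ W', w ∉ X₀ ∧ w ∉ X₁ ∧ ∀ e ∈ E₀ ∪ E₁, w ∉ e := by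
    intro w hw
    simp only [hW'def, Finset.mem_sdiff, Finset.mem_union, Finset.mem_biUnion, id] at hw
    push Not at hw
    exact ⟨hw.2.1.1, hw.2.1.2, fun e he => hw.2.2 e (Finset.mem_union.1 he)⟩
  have hzz : z ≠ z' := fun hh =>
    Finset.disjoint_left.1 hX h₀.path.left_mem (hh ▸ h₁.path.left_mem)
  have hedge : ∀ w ∈ W', ∀ e ∈ E₀ ∪ E₁, e ∉ edgesOver H A {w} := by
    intro w hw e he heo
    have h1 := (Finset.mem_filter.1 heo).2
    have h2 : w ∈ e \ A := h1 ▸ Finset.mem_singleton_self w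
    exact (hout w hw).2.2 e he (Finset.mem_sdiff.1 h2).1
  obtain ⟨X, E, hp, hEs, hc⟩ := (h.isPassFamily hr har (W' := W') Finset.sdiff_subset).exists_two_tailed
    (by rw [Finset.card_image_of_injective _ Finset.singleton_injective]; omega)
    h₀.mem h₁.mem (Or.inl hzz) h₀.path h₁.path h₀.inter h₁.inter
    ((Finset.disjoint_iff_inter_eq_empty.1 hX).subset.trans (Finset.empty_subset _)) hE
    (by
      intro K hK
      obtain ⟨w, hw, rfl⟩ := Finset.mem_image.1 hK
      exact Finset.disjoint_singleton_right.2 (hout w hw).1)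
    (by
      intro K hK
      obtain ⟨w, hw, rfl⟩ := Finset.mem_image.1 hK
      exact Finset.disjoint_singleton_right.2 (hout w hw).2.1)
    (by
      intro K hK
      obtain ⟨w, hw, rfl⟩ := Finset.mem_image.1 hK
      exact Finset.disjoint_left.2 fun e he => hedge w hw e (Finset.mem_union_left _ he))
    (by
      intro K hK
      obtain ⟨w, hw, rfl⟩ := Finset.mem_image.1 hK
      exact Finset.disjoint_left.2 fun e he => hedge w hw e (Finset.mem_union_right _ he))
  refine hc.trans_lt (hp.card_lt hk (hEs.trans ?_))
  refine Finset.union_subset (Finset.union_subset h₀.subset h₁.subset) ?_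
  exact Finset.biUnion_subset.2 fun K _ => Finset.filter_subset _ _

theorem IsCore.tail_card_lt {W : Finset V} (h : IsCore H r A W) (hr : 2 ≤ r)
    (har : r ≤ A.card) (hu : ∀ e ∈ H, e.card = r) (hk : IsEmpty (BergePath H k))
    (hW : 2 * k + r * (2 * k) + A.card ≤ W.card) (h₀ : IsTail H A z w X E) :
    E.card + 1 + 2 * (A.card - 1) < k := by
  have hc := h₀.path.card_lt hk h₀.subset
  have hX := h₀.path.card_eq
  have hEc : (E.biUnion id).card ≤ r * (2 * k) := by
    refine (Finset.card_biUnion_le_card_mul _ _ r fun e he => (hu e (h₀.subset he)).le).trans ?_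
    rw [mul_comm]
    exact Nat.mul_le_mul_left _ (by omega)
  have hUc := Finset.card_union_le X (E.biUnion id)
  obtain ⟨v, hv⟩ := Finset.card_pos.1 (show 0 < (W \ (X ∪ E.biUnion id)).card by
    have := Finset.le_card_sdiff (X ∪ E.biUnion id) W; omega)
  simp only [Finset.mem_sdiff, Finset.mem_union, Finset.mem_biUnion, id] at hv
  push Not at hv
  obtain ⟨hvW, hvX, hvE⟩ := hv
  have hvA := Finset.disjoint_left.1 h.disjoint hvW
  obtain ⟨z', hz', hzz⟩ := Finset.exists_mem_ne (s := A) (by omega) z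
  obtain ⟨e, he, hve, hz'e, hze⟩ := h.exists_edge hr har hvW hz' h₀.mem hzz
  have h₁ : IsTail H A z' v {z', v} {e} :=
    IsTail.single hz' hvA (Finset.mem_filter.1 he).1 hz'e hve
  refine h.tails_card_lt hr har hu hk hW h₀ h₁ ?_ ?_
  · rw [Finset.disjoint_insert_right, Finset.disjoint_singleton_right]
    exact ⟨fun hh => hzz (Finset.mem_singleton.1 (h₀.inter (Finset.mem_inter.2 ⟨hh, hz'⟩))), hvX⟩
  · rw [Finset.disjoint_singleton_right]
    exact fun hh => hvE e hh hve

end Tail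

section Sparse

variable {V : Type*} {H G : Finset (Finset V)} {A : Finset V} {z z' w v x y u : V}
  {X : Finset V} {E : Finset (Finset V)} {e e' f g : Finset V} {r L : ℕ}

theorem IsTail.subset_union (hs : ∀ z w X E, IsTail H A z w X E → E.card ≤ L)
    (h : IsTail H A z v X E) (hE : E.card = L) (he : e ∈ H) (heE : e ∉ E) (hv : v ∈ e) :
    e ⊆ A ∪ X := by
  intro u hu
  by_contra hn
  rw [Finset.mem_union, not_or] at hn
  have := hs _ _ _ _ (h.snoc hn.2 hn.1 heE he hv hu)
  rw [Finset.card_insert_of_notMem heE] at this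
  omega

theorem exists_mem_notMem_of_degree {n : ℕ} {P : Finset (Finset V)}
    (hd : n ≤ (G.filter (fun e => v ∈ e)).card) (hP : P.card < n) :
    ∃ f ∈ G, v ∈ f ∧ f ∉ P := by
  obtain ⟨f, hf, hfP⟩ := Finset.exists_mem_notMem_of_card_lt_card (hP.trans_le hd)
  rw [Finset.mem_filter] at hf
  exact ⟨f, hf.1, hf.2, hfP⟩

theorem inter_nonempty_of_subset_union {Y : Finset V} (hf : f ⊆ A ∪ Y) (hc : Y.card < f.card) :
    ∃ z ∈ f, z ∈ A := by
  obtain ⟨z, hz, hzY⟩ := Finset.exists_mem_notMem_of_card_lt_card hc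
  exact ⟨z, hz, (Finset.mem_union.1 (hf hz)).resolve_right hzY⟩

/-- A family `G ⊆ H` of edges inside `S ⊇ A` in which every vertex of `S` outside `A` has degree
at least `4`, where every vertex is the end of a tail, and tails have length at most `L`. -/
structure IsSparse (H G : Finset (Finset V)) (S A : Finset V) (r L : ℕ) : Prop where
  three_le : 3 ≤ r
  uniform : ∀ e ∈ H, e.card = r
  subset : G ⊆ H
  edge_subset : ∀ e ∈ G, e ⊆ S
  degree : ∀ v ∈ S, v ∉ A → 4 ≤ (G.filter (fun e => v ∈ e)).card
  exists_tail : ∀ v, ∃ z X E, IsTail H A z v X E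
  tail_card_le : ∀ z w X E, IsTail H A z w X E → E.card ≤ L

variable {S : Finset V}

theorem IsSparse.card_sdiff_le_one (h : IsSparse H G S A r 1) (he : e ∈ G) :
    (e \ A).card ≤ 1 := by
  by_contra hc
  obtain ⟨x, hx, y, hy, hxy⟩ := Finset.one_lt_card.1 (not_le.1 hc)
  rw [Finset.mem_sdiff] at hx hy
  have key : ∀ z g, z ∈ A → g ∈ H → z ∈ g → x ∈ g → g = e := by
    intro z g hz hg hzg hxg
    by_contra hne
    have h1 := (IsTail.single hz hx.2 hg hzg hxg).subset_union h.tail_card_le (by simp)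
      (h.subset he) (by simpa using Ne.symm hne) hx.1 hy.1
    simp only [Finset.mem_union, Finset.mem_insert, Finset.mem_singleton] at h1
    rcases h1 with h1 | rfl | rfl
    · exact hy.2 h1
    · exact hy.2 hz
    · exact hxy rfl
  obtain ⟨z, X, E, ht⟩ := h.exists_tail x
  have hE : E.card = 1 := le_antisymm (h.tail_card_le _ _ _ _ ht) (ht.card_pos hx.2)
  obtain ⟨g, rfl, hzg, hxg, rfl⟩ := ht.path.eq_of_card_eq_one hE
  obtain rfl := key z g ht.mem (ht.subset (by simp)) hzg hxg
  obtain ⟨g', hg', hxg', hne⟩ := exists_mem_notMem_of_degree (P := {g})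
    (h.degree x (h.edge_subset g he hx.1) hx.2) (by simp)
  have hsub := ht.subset_union h.tail_card_le hE (h.subset hg') hne hxg'
  obtain ⟨z', hz'g', hz'⟩ := inter_nonempty_of_subset_union hsub
    (by rw [h.uniform g' (h.subset hg')]; exact Finset.card_le_two.trans_lt h.three_le)
  exact hne (Finset.mem_singleton.2 (key z' g' hz' (h.subset hg') hz'g' hxg'))

theorem IsSparse.exists_edge_of_tail (h : IsSparse H G S A r 2) (hvS : v ∈ S) (hv : v ∉ A)
    (ht : IsTail H A z v X E) (hE : E.card = 2) (e : Finset V) :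
    ∃ f ∈ G, v ∈ f ∧ f ∉ E ∧ f ≠ e ∧ ∃ z ∈ f, z ∈ A := by
  obtain ⟨f, hf, hvf, hfP⟩ := exists_mem_notMem_of_degree (P := insert e E) (h.degree v hvS hv)
    ((Finset.card_insert_le _ _).trans_lt (by omega))
  rw [Finset.mem_insert, not_or] at hfP
  refine ⟨f, hf, hvf, hfP.2, hfP.1, inter_nonempty_of_subset_union (Y := X.erase z) ?_ ?_⟩
  · intro y hy
    have h1 := ht.subset_union h.tail_card_le hE (h.subset hf) hfP.2 hvf hy
    rw [Finset.mem_union] at h1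
    rw [Finset.mem_union, Finset.mem_erase]
    by_cases hyz : y = z
    · exact Or.inl (hyz ▸ ht.mem)
    · tauto
  · rw [h.uniform f (h.subset hf), Finset.card_erase_of_mem ht.path.left_mem, ht.path.card_eq, hE]
    have := h.three_le
    omega

theorem IsSparse.exists_edge_meeting (h : IsSparse H G S A r 2) (hxS : x ∈ S) (hx : x ∉ A)
    (e : Finset V) : ∃ g ∈ H, g ≠ e ∧ x ∈ g ∧ ∃ z ∈ g, z ∈ A := by
  obtain ⟨z, X, E, ht⟩ := h.exists_tail x
  have h2 := h.tail_card_le _ _ _ _ ht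
  have h1 := ht.card_pos hx
  by_cases hE : E.card = 2
  · obtain ⟨f, hf, hxf, -, hfe, hz⟩ := h.exists_edge_of_tail hxS hx ht hE e
    exact ⟨f, h.subset hf, hfe, hxf, hz⟩
  obtain ⟨g, rfl, hzg, hxg, rfl⟩ := ht.path.eq_of_card_eq_one (by omega)
  have hgH : g ∈ H := ht.subset (by simp)
  by_cases hge : g = e
  swap
  · exact ⟨g, hgH, hge, hxg, z, hzg, ht.mem⟩
  subst hge
  obtain ⟨g', hg', hxg', hne⟩ := exists_mem_notMem_of_degree (P := {g})
    (h.degree x hxS hx) (by simp)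
  by_cases hm : ∃ z ∈ g', z ∈ A
  · exact ⟨g', h.subset hg', by simpa using hne, hxg', hm⟩
  push Not at hm
  obtain ⟨u, hug', hux⟩ := Finset.exists_mem_ne (s := g')
    (by rw [h.uniform _ (h.subset hg')]; have := h.three_le; omega) x
  have huA := hm u hug'
  have huz : u ≠ z := fun hh => huA (hh ▸ ht.mem)
  have ht2 := ht.snoc (v := u) (by simpa using ⟨huz, hux⟩) huA hne (h.subset hg') hxg' hug'
  obtain ⟨f, hf, huf, hfE, hfg, z', hz'f, hz'⟩ := h.exists_edge_of_tail
    (h.edge_subset g' hg' hug') huA ht2 (by rw [Finset.card_insert_of_notMem hne]; simp) g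
  by_cases hxf : x ∈ f
  · exact ⟨f, h.subset hf, hfg, hxf, z', hz'f, hz'⟩
  have hxz' : x ≠ z' := fun hh => hx (hh ▸ hz')
  rw [Finset.mem_insert, not_or] at hfE
  have ht3 := (IsTail.single hz' huA (h.subset hf) hz'f huf).snoc (v := x) (e := g')
    (by simpa using ⟨hxz', hux.symm⟩) hx (by simpa using Ne.symm hfE.1) (h.subset hg') hug' hxg'
  obtain ⟨p, hp, hxp, -, hpe, hz⟩ := h.exists_edge_of_tail hxS hx ht3
    (by rw [Finset.card_insert_of_notMem (by simpa using Ne.symm hfE.1)]; simp) g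
  exact ⟨p, h.subset hp, hpe, hxp, hz⟩

theorem IsSparse.subset_of_ne (h : IsSparse H G S A r 2) (he : e ∈ H) (hx : x ∈ e) (hxA : x ∉ A)
    (hy : y ∈ e) (hyA : y ∉ A) (hxy : x ≠ y) (hg : g ∈ H) (hge : g ≠ e) (hxg : x ∈ g)
    (hgA : ∃ z ∈ g, z ∈ A) (hf : f ∈ H) (hyf : y ∈ f) (hfe : f ≠ e) (hfg : f ≠ g) :
    f ⊆ A ∪ {x, y} := by
  obtain ⟨z, hzg, hz⟩ := hgA
  have hyz : y ≠ z := fun hh => hyA (hh ▸ hz)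
  have ht := (IsTail.single hz hxA hg hzg hxg).snoc (v := y) (e := e)
    (by simpa using ⟨hyz, hxy.symm⟩) hyA (by simpa using hge.symm) he hx hy
  have := ht.subset_union h.tail_card_le
    (by rw [Finset.card_insert_of_notMem (by simpa using hge.symm)]; simp) hf
    (by simpa using ⟨hfe, hfg⟩) hyf
  intro v hv
  have h1 := this hv
  simp only [Finset.mem_union, Finset.mem_insert, Finset.mem_singleton] at h1 ⊢
  rcases h1 with h1 | h1 | rfl | h1
  · tauto
  · tauto
  · exact Or.inl hz
  · tauto

theorem IsSparse.exists_pure_edge (h : IsSparse H G S A r 2) (he : e ∈ G)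
    (hx : x ∈ e \ A) (hy : y ∈ e \ A) (hu : u ∈ e \ A) (hxy : x ≠ y) (hxu : x ≠ u) (hyu : y ≠ u) :
    ∃ p ∈ H, p ≠ e ∧ x ∈ p ∧ p ⊆ A ∪ {x} := by
  rw [Finset.mem_sdiff] at hx hy hu
  have heS := h.edge_subset e he
  obtain ⟨gy, hgy, hgye, hygy, hgyA⟩ := h.exists_edge_meeting (heS hy.1) hy.2 e
  obtain ⟨gu, hgu, hgue, hugu, hguA⟩ := h.exists_edge_meeting (heS hu.1) hu.2 e
  obtain ⟨p, hp, hxp, hpP⟩ := exists_mem_notMem_of_degree (P := {e, gy, gu})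
    (h.degree x (heS hx.1) hx.2) (Finset.card_le_three.trans_lt (by omega))
  simp only [Finset.mem_insert, Finset.mem_singleton, not_or] at hpP
  refine ⟨p, h.subset hp, hpP.1, hxp, ?_⟩
  have h1 := h.subset_of_ne (h.subset he) hy.1 hy.2 hx.1 hx.2 hxy.symm hgy hgye hygy hgyA
    (h.subset hp) hxp hpP.1 hpP.2.1
  have h2 := h.subset_of_ne (h.subset he) hu.1 hu.2 hx.1 hx.2 hxu.symm hgu hgue hugu hguA
    (h.subset hp) hxp hpP.1 hpP.2.2
  intro v hv
  have h3 := h1 hv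
  have h4 := h2 hv
  simp only [Finset.mem_union, Finset.mem_insert, Finset.mem_singleton] at h3 h4 ⊢
  rcases h3 with h3 | rfl | h3
  · exact Or.inl h3
  · rcases h4 with h4 | h4 | h4
    · exact Or.inl h4
    · exact absurd h4 hyu
    · exact Or.inr h4
  · exact Or.inr h3

theorem IsSparse.subset_of_three (h : IsSparse H G S A r 2) (he : e ∈ G)
    (hx : x ∈ e \ A) (hy : y ∈ e \ A) (hu : u ∈ e \ A) (hxy : x ≠ y) (hxu : x ≠ u) (hyu : y ≠ u)
    (hf : f ∈ H) (hyf : y ∈ f) (hfe : f ≠ e) : f ⊆ A ∪ {y} := by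
  obtain ⟨p, hp, hpe, hxp, hpA⟩ := h.exists_pure_edge he hx hy hu hxy hxu hyu
  obtain ⟨q, hq, hqe, huq, hqA⟩ := h.exists_pure_edge he hu hx hy hxu.symm hyu.symm hxy
  rw [Finset.mem_sdiff] at hx hy hu
  have hr := h.three_le
  have h1 := h.subset_of_ne (h.subset he) hx.1 hx.2 hy.1 hy.2 hxy hp hpe hxp
    (inter_nonempty_of_subset_union hpA (by rw [h.uniform p hp, Finset.card_singleton]; omega))
    hf hyf hfe (by
      rintro rfl
      have := hpA hyf
      simp only [Finset.mem_union, Finset.mem_singleton] at this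
      exact this.elim hy.2 hxy.symm)
  have h2 := h.subset_of_ne (h.subset he) hu.1 hu.2 hy.1 hy.2 hyu.symm hq hqe huq
    (inter_nonempty_of_subset_union hqA (by rw [h.uniform q hq, Finset.card_singleton]; omega))
    hf hyf hfe (by
      rintro rfl
      have := hqA hyf
      simp only [Finset.mem_union, Finset.mem_singleton] at this
      exact this.elim hy.2 hyu)
  intro v hv
  have h3 := h1 hv
  have h4 := h2 hv
  simp only [Finset.mem_union, Finset.mem_insert, Finset.mem_singleton] at h3 h4 ⊢
  rcases h3 with h3 | rfl | h3
  · exact Or.inl h3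
  · rcases h4 with h4 | h4 | h4
    · exact Or.inl h4
    · exact absurd h4 hxu
    · exact Or.inr h4
  · exact Or.inr h3

theorem IsSparse.card_sdiff_eq_two (h : IsSparse H G S A r 2) (he : e ∈ G) (hf : f ∈ G)
    (hef : e ≠ f) (hec : 2 ≤ (e \ A).card) (hfc : 2 ≤ (f \ A).card) (hv : v ∈ e \ A)
    (hvf : v ∈ f \ A) : (e \ A).card = 2 := by
  by_contra hne
  obtain ⟨x, hx, u, hu, hxu⟩ := Finset.one_lt_card.1
    (show 1 < ((e \ A).erase v).card by rw [Finset.card_erase_of_mem hv]; omega)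
  rw [Finset.mem_erase] at hx hu
  have h1 := h.subset_of_three he hx.2 hv hu.2 hx.1 hxu hu.1.symm (h.subset hf)
    (Finset.mem_sdiff.1 hvf).1 hef.symm
  have h2 : f \ A ⊆ {v} := by
    intro w hw
    rw [Finset.mem_sdiff] at hw
    exact (Finset.mem_union.1 (h1 hw.1)).resolve_left hw.2
  have := Finset.card_le_card h2
  rw [Finset.card_singleton] at this
  omega

theorem IsSparse.sdiff_eq (h : IsSparse H G S A r 2) (he : e ∈ G) (hf : f ∈ G)
    (hef : e ≠ f) (hec : 2 ≤ (e \ A).card) (hfc : 2 ≤ (f \ A).card) (hv : v ∈ e \ A)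
    (hvf : v ∈ f \ A) : e \ A = f \ A := by
  have he2 := h.card_sdiff_eq_two he hf hef hec hfc hv hvf
  have hf2 := h.card_sdiff_eq_two hf he hef.symm hfc hec hvf hv
  obtain ⟨x, hx, hxv⟩ := Finset.exists_mem_ne (s := e \ A) (by omega) v
  have heq : e \ A = {x, v} := (Finset.eq_of_subset_of_card_le
    (Finset.insert_subset hx (Finset.singleton_subset_iff.2 hv))
    (by rw [he2, Finset.card_pair hxv])).symm
  rw [Finset.mem_sdiff] at hv hx
  obtain ⟨g, hg, hge, hxg, hgA⟩ := h.exists_edge_meeting (h.edge_subset e he hx.1) hx.2 e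
  by_cases hfg : f = g
  · rw [heq]
    refine Finset.eq_of_subset_of_card_le (Finset.insert_subset ?_
      (Finset.singleton_subset_iff.2 hvf)) (by rw [hf2, Finset.card_pair hxv])
    exact Finset.mem_sdiff.2 ⟨hfg ▸ hxg, hx.2⟩
  · have h1 := h.subset_of_ne (h.subset he) hx.1 hx.2 hv.1 hv.2 hxv hg hge hxg hgA (h.subset hf)
      (Finset.mem_sdiff.1 hvf).1 hef.symm hfg
    symm
    refine Finset.eq_of_subset_of_card_le ?_ (by omega)
    intro w hw
    rw [Finset.mem_sdiff] at hw
    rw [heq]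
    exact (Finset.mem_union.1 (h1 hw.1)).resolve_left hw.2

theorem IsSparse.not_disjoint (h : IsSparse H G S A r 2)
    (ht : ∀ z z' w w' X X' E E', IsTail H A z w X E → IsTail H A z' w' X' E' → Disjoint X X' →
      Disjoint E E' → E.card + E'.card ≤ 3)
    (he : e ∈ G) (he' : e' ∈ G) (hec : 2 ≤ (e \ A).card) (he'c : 2 ≤ (e' \ A).card) :
    ¬ Disjoint (e \ A) (e' \ A) := by
  intro hdis
  obtain ⟨x, hx, y, hy, hxy⟩ := Finset.one_lt_card.1 hec
  obtain ⟨x', hx', y', hy', hxy'⟩ := Finset.one_lt_card.1 he'c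
  have hd : ∀ v ∈ e \ A, ∀ w ∈ e' \ A, v ≠ w := fun v hv w hw hh =>
    Finset.disjoint_left.1 hdis hv (hh ▸ hw)
  have hxx' := hd x hx x' hx'
  have hxy'' := hd x hx y' hy'
  have hyx' := hd y hy x' hx'
  have hyy' := hd y hy y' hy'
  have hx'e : x' ∉ e := fun hh =>
    hd x' (Finset.mem_sdiff.2 ⟨hh, (Finset.mem_sdiff.1 hx').2⟩) x' hx' rfl
  rw [Finset.mem_sdiff] at hx hy hx' hy'
  obtain ⟨g', hg', hg'e', hx'g', z', hz'g', hz'⟩ :=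
    h.exists_edge_meeting (h.edge_subset e' he' hx'.1) hx'.2 e'
  obtain ⟨g, hg, hge, hyg, hgA⟩ := h.exists_edge_meeting (h.edge_subset e he hy.1) hy.2 e
  obtain ⟨f, hf, hxf, hfP⟩ := exists_mem_notMem_of_degree (P := {e, g, {x, y, z'}})
    (h.degree x (h.edge_subset e he hx.1) hx.2) (Finset.card_le_three.trans_lt (by omega))
  simp only [Finset.mem_insert, Finset.mem_singleton, not_or] at hfP
  have hfA := h.subset_of_ne (h.subset he) hy.1 hy.2 hx.1 hx.2 hxy.symm hg hge hyg hgA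
    (h.subset hf) hxf hfP.1 hfP.2.1
  have hfr := h.uniform f (h.subset hf)
  have hr := h.three_le
  have hz : ∃ z ∈ f, z ∈ A ∧ z ≠ z' := by
    by_contra hno
    push Not at hno
    refine hfP.2.2 (Finset.eq_of_subset_of_card_le ?_ (Finset.card_le_three.trans (by omega)))
    intro v hv
    have h1 := hfA hv
    simp only [Finset.mem_union, Finset.mem_insert, Finset.mem_singleton] at h1 ⊢
    rcases h1 with h1 | h1 | h1
    · exact Or.inr (Or.inr (hno v hv h1))
    · exact Or.inr (Or.inl h1)
    · exact Or.inl h1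
  obtain ⟨z, hzf, hz, hzz'⟩ := hz
  have hx'f : x' ∉ f := by
    intro hh
    have h1 := hfA hh
    simp only [Finset.mem_union, Finset.mem_insert, Finset.mem_singleton] at h1
    rcases h1 with h1 | h1 | h1
    · exact hx'.2 h1
    · exact hyx' h1.symm
    · exact hxx' h1.symm
  have hne : ∀ {v w : V}, v ∈ A → w ∉ A → w ≠ v := fun hv hw hh => hw (hh ▸ hv)
  have hef : e ∉ ({f} : Finset (Finset V)) := by simpa using Ne.symm hfP.1
  have he'g' : e' ∉ ({g'} : Finset (Finset V)) := by simpa using hg'e'.symm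
  have ht₀ := (IsTail.single hz hx.2 (h.subset hf) hzf hxf).snoc (v := y) (e := e)
    (by simpa using ⟨hne hz hy.2, hxy.symm⟩) hy.2 hef (h.subset he) hx.1 hy.1
  have ht₁ := (IsTail.single hz' hx'.2 hg' hz'g' hx'g').snoc (v := y') (e := e')
    (by simpa using ⟨hne hz' hy'.2, hxy'.symm⟩) hy'.2 he'g' (h.subset he') hx'.1 hy'.1
  have h1 := hne hz' hx.2
  have h2 := hne hz' hy.2
  have h3 := (hne hz hx'.2).symm
  have h4 := (hne hz hy'.2).symm
  have hfin := ht _ _ _ _ _ _ _ _ ht₀ ht₁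
    (by
      simp only [Finset.disjoint_insert_left, Finset.disjoint_singleton_left, Finset.mem_insert,
        Finset.mem_singleton, not_or]
      exact ⟨⟨hyy', h2, hyx'⟩, ⟨h4, hzz', h3⟩, hxy'', h1, hxx'⟩)
    (by
      simp only [Finset.disjoint_insert_left, Finset.disjoint_singleton_left, Finset.mem_insert,
        Finset.mem_singleton, not_or]
      exact ⟨⟨fun hh => hx'e (hh ▸ hx'.1), fun hh => hx'e (hh ▸ hx'g')⟩,
        fun hh => hx'f (hh ▸ hx'.1), fun hh => hx'f (hh ▸ hx'g')⟩)
  rw [Finset.card_insert_of_notMem hef, Finset.card_insert_of_notMem he'g'] at hfin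
  simp at hfin

theorem IsSparse.card_bad_le (h : IsSparse H G S A r 2) (hrA : r ≤ A.card)
    (ht : ∀ z z' w w' X X' E E', IsTail H A z w X E → IsTail H A z' w' X' E' → Disjoint X X' →
      Disjoint E E' → E.card + E'.card ≤ 3) :
    (G.filter (fun e => 2 ≤ (e \ A).card)).card ≤ A.card.choose (r - 2) := by
  have hpos : 0 < A.card.choose (r - 2) := Nat.choose_pos (by omega)
  by_cases hc : (G.filter (fun e => 2 ≤ (e \ A).card)).card ≤ 1
  · omega
  have hpair : ∀ e ∈ G.filter (fun e => 2 ≤ (e \ A).card),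
      ∀ f ∈ G.filter (fun e => 2 ≤ (e \ A).card), e ≠ f → e \ A = f \ A ∧ (e \ A).card = 2 := by
    intro e he f hf hef
    rw [Finset.mem_filter] at he hf
    obtain ⟨v, hv, hvf⟩ := Finset.not_disjoint_iff.1 (h.not_disjoint ht he.1 hf.1 he.2 hf.2)
    exact ⟨h.sdiff_eq he.1 hf.1 hef he.2 hf.2 hv hvf,
      h.card_sdiff_eq_two he.1 hf.1 hef he.2 hf.2 hv hvf⟩
  obtain ⟨e₀, he₀, e₁, he₁, h01⟩ := Finset.one_lt_card.1 (not_le.1 hc)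
  have hall : ∀ e ∈ G.filter (fun e => 2 ≤ (e \ A).card), e \ A = e₀ \ A := by
    intro e he
    by_cases hee : e = e₀
    · rw [hee]
    · exact (hpair e he e₀ he₀ hee).1
  have h2 := (hpair e₀ he₀ e₁ he₁ h01).2
  rw [← Finset.card_powersetCard]
  refine Finset.card_le_card_of_injOn (fun e => e ∩ A) ?_ ?_
  · intro e he
    rw [Finset.mem_coe] at he
    rw [Finset.mem_coe, Finset.mem_powersetCard]
    refine ⟨Finset.inter_subset_right, ?_⟩
    have h3 := Finset.card_sdiff_add_card_inter e A
    rw [hall e he, h2, h.uniform e (h.subset (Finset.mem_filter.1 he).1)] at h3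
    change (e ∩ A).card = r - 2
    omega
  · intro e he f hf hef
    rw [Finset.mem_coe] at he hf
    rw [← Finset.sdiff_union_inter e A, ← Finset.sdiff_union_inter f A, hall e he, hall f hf]
    exact congrArg _ hef

end Sparse

section UpperBound

variable {V : Type*} {H G : Finset (Finset V)} {A S : Finset V} {r k a : ℕ}

/-- Adjoining a vertex outside `A` to the `s`-subsets of `A`. -/
theorem mem_insert_powersetCard {e : Finset V} {v : V} (hr : 1 ≤ r) :
    e ∈ (A.powersetCard (r - 1)).image (insert v) ∧ v ∉ A ↔ e.card = r ∧ e \ A = {v} := by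
  constructor
  · rintro ⟨he, hv⟩
    obtain ⟨R, hR, rfl⟩ := Finset.mem_image.1 he
    rw [Finset.mem_powersetCard] at hR
    refine ⟨?_, ?_⟩
    · rw [Finset.card_insert_of_notMem (fun h => hv (hR.1 h)), hR.2]
      omega
    · rw [Finset.insert_sdiff_of_notMem _ hv, Finset.sdiff_eq_empty_iff_subset.2 hR.1]
      rfl
  · rintro ⟨hc, he⟩
    have hv : v ∈ e \ A := he ▸ Finset.mem_singleton_self v
    have hsum := Finset.card_sdiff_add_card_inter e A
    rw [he, Finset.card_singleton] at hsum
    refine ⟨Finset.mem_image.2 ⟨e ∩ A, Finset.mem_powersetCard.2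
      ⟨Finset.inter_subset_right, by omega⟩, ?_⟩, (Finset.mem_sdiff.1 hv).2⟩
    rw [Finset.insert_eq, ← he, Finset.sdiff_union_inter]

theorem card_good_le (hr : 1 ≤ r) (hAS : A ⊆ S) (hG : ∀ e ∈ G, e.card = r ∧ e ⊆ S) :
    (G.filter (fun e => (e \ A).card ≤ 1)).card ≤
      A.card.choose r + (S.card - A.card) * A.card.choose (r - 1) := by
  have hsub : G.filter (fun e => (e \ A).card ≤ 1) ⊆ A.powersetCard r ∪
      (S \ A).biUnion (fun v => (A.powersetCard (r - 1)).image (insert v)) := by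
    intro e he
    rw [Finset.mem_filter] at he
    obtain ⟨hc, heS⟩ := hG e he.1
    rw [Finset.mem_union, Finset.mem_powersetCard, Finset.mem_biUnion]
    rcases (e \ A).eq_empty_or_nonempty with h0 | h0
    · exact Or.inl ⟨Finset.sdiff_eq_empty_iff_subset.1 h0, hc⟩
    · obtain ⟨v, hv⟩ := Finset.card_eq_one.1 (le_antisymm he.2 h0.card_pos)
      have hve : v ∈ e \ A := hv ▸ Finset.mem_singleton_self v
      rw [Finset.mem_sdiff] at hve
      exact Or.inr ⟨v, Finset.mem_sdiff.2 ⟨heS hve.1, hve.2⟩,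
        ((mem_insert_powersetCard hr).2 ⟨hc, hv⟩).1⟩
  refine (Finset.card_le_card hsub).trans ((Finset.card_union_le _ _).trans ?_)
  rw [Finset.card_powersetCard, ← Finset.card_sdiff_of_subset hAS]
  refine Nat.add_le_add_left (Finset.card_biUnion_le_card_mul _ _ _ fun v _ => ?_) _
  exact Finset.card_image_le.trans (Finset.card_powersetCard _ _).le

/-- Passing to a suitable vertex set `S ⊇ A` all minimum degrees outside `A` become large. -/
theorem exists_dense_superset [Fintype V] (H : Finset (Finset V)) (A : Finset V) (D : ℕ) :
    ∃ S, A ⊆ S ∧ (∀ v ∈ S, v ∉ A → D ≤ ((restrictTo H S).filter (fun e => v ∈ e)).card) ∧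
      (H.card : ℤ) - D * Fintype.card V ≤ (restrictTo H S).card - D * S.card := by
  obtain ⟨S, hS, hmax⟩ := Finset.exists_max_image
    ((Finset.univ : Finset (Finset V)).filter (fun S => A ⊆ S))
    (fun S => ((restrictTo H S).card : ℤ) - D * S.card)
    ⟨A, by simp⟩
  rw [Finset.mem_filter] at hS
  refine ⟨S, hS.2, ?_, ?_⟩
  · intro v hv hvA
    have h1 := hmax (S.erase v) (Finset.mem_filter.2 ⟨Finset.mem_univ _, fun x hx =>
      Finset.mem_erase.2 ⟨fun hh => hvA (hh ▸ hx), hS.2 hx⟩⟩)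
    have h2 : restrictTo H (S.erase v) = (restrictTo H S).filter (fun e => ¬ v ∈ e) := by
      ext e
      simp only [restrictTo, Finset.mem_filter, Finset.subset_erase, and_assoc]
    have h3 := Finset.card_filter_add_card_filter_not (s := restrictTo H S) (fun e => v ∈ e)
    have h4 := Finset.card_erase_add_one hv
    rw [h2] at h1
    have h5 : (S.card : ℤ) = (S.erase v).card + 1 := by exact_mod_cast h4.symm
    rw [h5] at h1
    zify at h3 ⊢
    linarith
  · have h1 := hmax Finset.univ (by simp)
    have h2 : restrictTo H Finset.univ = H := by simp [restrictTo]
    rw [h2, Finset.card_univ] at h1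
    exact h1

theorem IsCore.card_le_extremalCount [Fintype V] {W : Finset V} (h : IsCore H r A W)
    (hr : 3 ≤ r) (hk : 2 * r + 13 ≤ k) (hA : A.card = (k - 1) / 2)
    (hu : ∀ e ∈ H, e.card = r) (hH : HConnected H) (hP : IsEmpty (BergePath H k))
    (hW : 2 * k + r * (2 * k) + A.card ≤ W.card) :
    H.card ≤ extremalCount r k (Fintype.card V) := by
  have har : r + 6 ≤ A.card := by omega
  obtain ⟨S, hAS, hdeg, hS⟩ := exists_dense_superset H A (A.card.choose (r - 1))
  have hD : 4 ≤ A.card.choose (r - 1) := by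
    have := add_three_le_choose (n := A.card) (s := r - 1) (by omega) (by omega)
    omega
  have hsp : ∀ L, k ≤ 2 * A.card + L → IsSparse H (restrictTo H S) S A r L := fun L hL =>
    { three_le := hr
      uniform := hu
      subset := Finset.filter_subset _ _
      edge_subset := fun e he => (Finset.mem_filter.1 he).2
      degree := fun v hv hvA => hD.trans (hdeg v hv hvA)
      exists_tail := exists_isTail hH (Finset.card_pos.1 (by omega))
      tail_card_le := fun z w X E ht => by
        have := h.tail_card_lt (by omega) (by omega) hu hP hW ht
        omega }
  have hbad : ((restrictTo H S).filter (fun e => ¬ (e \ A).card ≤ 1)).card ≤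
      if 2 ∣ k then A.card.choose (r - 2) else 0 := by
    split_ifs with h2
    · have := (hsp 2 (by omega)).card_bad_le (by omega) (fun z z' w w' X X' E E' h₀ h₁ hX hE => by
        have := h.tails_card_lt (by omega) (by omega) hu hP hW h₀ h₁ hX hE
        omega)
      simpa only [not_le, Nat.succ_le_iff] using this
    · rw [Nat.le_zero, Finset.card_eq_zero, Finset.filter_eq_empty_iff]
      intro e he
      exact not_not.2 ((hsp 1 (by omega)).card_sdiff_le_one he)
  have hgood := card_good_le (G := restrictTo H S) (r := r) (by omega) hAS
    (fun e he => ⟨hu e (Finset.mem_filter.1 he).1, (Finset.mem_filter.1 he).2⟩)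
  have hsum := Finset.card_filter_add_card_filter_not (s := restrictTo H S)
    (fun e => (e \ A).card ≤ 1)
  have hAc := Finset.card_le_card hAS
  have hAV := Finset.card_le_univ A
  rw [extremalCount, ← hA]
  zify [hAV] at hS hgood hsum hbad ⊢
  rw [Nat.cast_sub hAc] at hgood
  have e1 : (((S.card : ℤ) - A.card) * (A.card.choose (r - 1) : ℤ)) =
    S.card * (A.card.choose (r - 1) : ℤ) - A.card * (A.card.choose (r - 1) : ℤ) := by ring
  split_ifs at hbad ⊢ <;> linarith

end UpperBound

section LowerBound

variable {V : Type*} {A : Finset V} {r k : ℕ} {T P : Finset (Finset V)}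

theorem exists_injOn_pairs {v : ℕ → V} {j a : ℕ} (hv : Set.InjOn v (Set.Iic k))
    (hA : ∀ i < k, i ≠ j → v i ∈ A ∨ v (i + 1) ∈ A)
    (hj : k ≤ j ∧ 2 * a + 1 ≤ k ∨ 2 * a + 2 ≤ k) : a + 1 ≤ A.card := by
  have hs : ∀ i ∈ Finset.range (a + 1), ∃ m, v m ∈ A ∧ m ≤ k ∧
      ((if 2 * i < j then 2 * i else 2 * i + 1) = m ∨
        (if 2 * i < j then 2 * i else 2 * i + 1) + 1 = m) := by
    intro i hi
    rw [Finset.mem_range] at hi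
    rcases hA (if 2 * i < j then 2 * i else 2 * i + 1) (by split_ifs <;> omega)
      (by split_ifs <;> omega) with h | h
    · exact ⟨_, h, by split_ifs <;> omega, Or.inl rfl⟩
    · exact ⟨_, h, by split_ifs <;> omega, Or.inr rfl⟩
  choose! m hmA hmk hm using hs
  rw [← Finset.card_range (a + 1)]
  refine Finset.card_le_card_of_injOn (fun i => v (m i)) (fun i hi => hmA i hi) ?_
  intro i hi i' hi' heq
  have h1 := hv (hmk i hi) (hmk i' hi') heq
  have h2 := hm i hi
  have h3 := hm i' hi'
  split_ifs at h2 h3 <;> omega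

variable [Fintype V]

/-- All `r`-sets whose part outside `A` belongs to `T`. -/
noncomputable def traceFamily (r : ℕ) (A : Finset V) (T : Finset (Finset V)) :
    Finset (Finset V) :=
  Finset.univ.filter (fun e => e.card = r ∧ e \ A ∈ T)

/-- The traces outside `A` allowed in the extremal construction: the sets with at most one
element, and the members of `P`. -/
noncomputable def smallTraces (A : Finset V) (P : Finset (Finset V)) : Finset (Finset V) :=
  insert ∅ ((Finset.univ \ A).image (fun v => {v}) ∪ P)

theorem mem_smallTraces {K : Finset V} :
    K ∈ smallTraces A P ↔ K = ∅ ∨ (∃ v ∉ A, {v} = K) ∨ K ∈ P := by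
  simp [smallTraces]

theorem card_traceFamily (hT : ∀ K ∈ T, Disjoint K A ∧ K.card ≤ r) :
    (traceFamily r A T).card = ∑ K ∈ T, A.card.choose (r - K.card) := by
  rw [Finset.card_eq_sum_card_fiberwise (f := fun e => e \ A) (t := T)
    (fun e he => (Finset.mem_filter.1 he).2.2)]
  refine Finset.sum_congr rfl fun K hK => ?_
  obtain ⟨hKA, hKr⟩ := hT K hK
  rw [← Finset.card_powersetCard]
  symm
  refine Finset.card_bij (fun R _ => K ∪ R) ?_ ?_ ?_
  · intro R hR
    rw [Finset.mem_powersetCard] at hR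
    have h1 : (K ∪ R) \ A = K := by
      rw [Finset.union_sdiff_distrib, Finset.sdiff_eq_empty_iff_subset.2 hR.1,
        Finset.union_empty, Finset.sdiff_eq_self_of_disjoint hKA]
    rw [Finset.mem_filter, traceFamily, Finset.mem_filter, h1]
    refine ⟨⟨Finset.mem_univ _, ?_, hK⟩, rfl⟩
    rw [Finset.card_union_of_disjoint (Finset.disjoint_of_subset_right hR.1 hKA), hR.2]
    omega
  · intro R hR R' hR' heq
    rw [Finset.mem_powersetCard] at hR hR'
    have h1 : ∀ R ⊆ A, (K ∪ R) ∩ A = R := by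
      intro R hR
      rw [Finset.union_inter_distrib_right, Finset.disjoint_iff_inter_eq_empty.1 hKA,
        Finset.empty_union, Finset.inter_eq_left.2 hR]
    rw [← h1 R hR.1, ← h1 R' hR'.1, heq]
  · intro e he
    rw [Finset.mem_filter, traceFamily, Finset.mem_filter] at he
    have h1 := Finset.card_sdiff_add_card_inter e A
    rw [he.2, he.1.2.1] at h1
    refine ⟨e ∩ A, Finset.mem_powersetCard.2 ⟨Finset.inter_subset_right, by omega⟩, ?_⟩
    rw [← he.2, Finset.sdiff_union_inter]

theorem card_traceFamily_smallTraces (hr : 2 ≤ r) (hP : ∀ K ∈ P, Disjoint K A ∧ K.card = 2) :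
    (traceFamily r A (smallTraces A P)).card = A.card.choose (r - 1) * (Fintype.card V - A.card) +
      A.card.choose r + P.card * A.card.choose (r - 2) := by
  have hT : ∀ K ∈ smallTraces A P, Disjoint K A ∧ K.card ≤ r := by
    intro K hK
    rcases mem_smallTraces.1 hK with rfl | ⟨v, hv, rfl⟩ | hK
    · simp
    · simpa using ⟨hv, by omega⟩
    · exact ⟨(hP K hK).1, by rw [(hP K hK).2]; exact hr⟩
  have hdis : Disjoint ((Finset.univ \ A).image (fun v => ({v} : Finset V))) P := by
    rw [Finset.disjoint_left]
    intro K hK hKP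
    obtain ⟨v, -, rfl⟩ := Finset.mem_image.1 hK
    have := (hP _ hKP).2
    simp at this
  have hemp : ∅ ∉ (Finset.univ \ A).image (fun v => ({v} : Finset V)) ∪ P := by
    intro h
    rcases Finset.mem_union.1 h with h | h
    · obtain ⟨v, -, hv⟩ := Finset.mem_image.1 h
      exact Finset.singleton_ne_empty v hv
    · have := (hP _ h).2
      simp at this
  have hsum : ∑ K ∈ P, A.card.choose (r - K.card) = P.card * A.card.choose (r - 2) := by
    rw [Finset.sum_congr rfl fun K hK => by rw [(hP K hK).2], Finset.sum_const, smul_eq_mul]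
  rw [card_traceFamily hT, smallTraces, Finset.sum_insert hemp, Finset.sum_union hdis, hsum,
    Finset.sum_image fun v _ w _ h => Finset.singleton_injective h]
  simp only [Finset.card_singleton, Finset.sum_const, Finset.card_empty, smul_eq_mul,
    Nat.sub_zero, Finset.card_sdiff_of_subset (Finset.subset_univ A), Finset.card_univ]
  ring

theorem mem_smallTraces_of_subset {K : Finset V} {v : V} (hK : K ⊆ {v}) (hKA : Disjoint K A) :
    K ∈ smallTraces A P := by
  rw [mem_smallTraces]
  rcases Finset.subset_singleton_iff.1 hK with rfl | rfl
  · exact Or.inl rfl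
  · exact Or.inr (Or.inl ⟨v, by simpa using hKA, rfl⟩)

theorem exists_mem_traceFamily (hr : 2 ≤ r) (hrA : r ≤ A.card) (P : Finset (Finset V)) (v : V)
    {z : V} (hz : z ∈ A) : ∃ e ∈ traceFamily r A (smallTraces A P), v ∈ e ∧ z ∈ e ∧ e \ A ⊆ {v} := by
  obtain ⟨e, he, heA, hec⟩ := Finset.exists_subsuperset_card_eq (s := {v, z}) (t := insert v A)
    (n := r) (Finset.insert_subset_insert _ (by simpa using hz))
    (Finset.card_le_two.trans hr) (hrA.trans (Finset.card_le_card (Finset.subset_insert _ _)))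
  have hsub : e \ A ⊆ {v} := by
    intro x hx
    rw [Finset.mem_sdiff] at hx
    have := heA hx.1
    rw [Finset.mem_insert] at this
    exact Finset.mem_singleton.2 (this.resolve_right hx.2)
  refine ⟨e, Finset.mem_filter.2 ⟨Finset.mem_univ _, hec,
    mem_smallTraces_of_subset hsub Finset.sdiff_disjoint⟩, he (by simp), he (by simp), hsub⟩

theorem hConnected_traceFamily (hr : 2 ≤ r) (hrA : r ≤ A.card) (P : Finset (Finset V)) :
    HConnected (traceFamily r A (smallTraces A P)) := by
  intro u v huv
  by_cases hv : v ∈ A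
  · obtain ⟨e, he, hue, hve, -⟩ := exists_mem_traceFamily hr hrA P u hv
    exact (PathOn.single huv hue hve).bergeReachable (by simpa using he)
  by_cases hu : u ∈ A
  · obtain ⟨e, he, hve, hue, -⟩ := exists_mem_traceFamily hr hrA P v hu
    exact (PathOn.single huv hue hve).bergeReachable (by simpa using he)
  obtain ⟨z, hz⟩ := Finset.card_pos.1 (show 0 < A.card by omega)
  obtain ⟨e, he, hue, hze, -⟩ := exists_mem_traceFamily hr hrA P u hz
  obtain ⟨f, hf, hvf, hzf, hfv⟩ := exists_mem_traceFamily hr hrA P v hz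
  have huz : u ≠ z := fun h => hu (h ▸ hz)
  have hvz : v ≠ z := fun h => hv (h ▸ hz)
  have hfe : f ≠ e := by
    rintro rfl
    exact huv (Finset.mem_singleton.1 (hfv (Finset.mem_sdiff.2 ⟨hue, hu⟩)))
  exact ((PathOn.single huz hue hze).snoc (w := v) (e := f) (by simpa using ⟨huv.symm, hvz⟩)
    (by simpa using hfe) hzf hvf).bergeReachable
    (Finset.insert_subset hf (by simpa using he))

theorem isEmpty_bergePath_traceFamily (hP : ∀ K ∈ P, K.card = 2)
    (hPk : P = ∅ ∧ 2 * A.card + 1 ≤ k ∨ P.card ≤ 1 ∧ 2 * A.card + 2 ≤ k) :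
    IsEmpty (BergePath (traceFamily r A (smallTraces A P)) k) := by
  refine ⟨fun B => ?_⟩
  set v : ℕ → V := fun i => if h : i < k + 1 then B.verts ⟨i, h⟩ else B.verts 0 with hv
  have hvi : ∀ i (h : i < k + 1), v i = B.verts ⟨i, h⟩ := fun i h => dite_cond_eq_true (eq_true h)
  have hinj : Set.InjOn v (Set.Iic k) := by
    intro i hi j hj hij
    rw [Set.mem_Iic] at hi hj
    rw [hvi i (by omega), hvi j (by omega)] at hij
    exact Fin.mk.inj_iff.1 (B.verts_inj hij)
  have hbad : ∀ i < k, v i ∉ A → v (i + 1) ∉ A → {v i, v (i + 1)} ∈ P := by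
    intro i hi h0 h1
    have hne : v i ≠ v (i + 1) := fun h => by
      have := hinj (Set.mem_Iic.2 hi.le) (Set.mem_Iic.2 hi) h
      omega
    have hmem := B.edges_mem ⟨i, hi⟩
    have hfst := B.fst_mem ⟨i, hi⟩
    have hsnd := B.snd_mem ⟨i, hi⟩
    have hfst' : v i ∈ B.edges ⟨i, hi⟩ := by rw [hvi i (by omega)]; exact hfst
    have hsnd' : v (i + 1) ∈ B.edges ⟨i, hi⟩ := by rw [hvi (i + 1) (by omega)]; exact hsnd
    have hsub : {v i, v (i + 1)} ⊆ B.edges ⟨i, hi⟩ \ A := Finset.insert_subset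
      (Finset.mem_sdiff.2 ⟨hfst', h0⟩) (Finset.singleton_subset_iff.2
        (Finset.mem_sdiff.2 ⟨hsnd', h1⟩))
    have hc := Finset.card_le_card hsub
    rw [Finset.card_pair hne] at hc
    have htr : B.edges ⟨i, hi⟩ \ A ∈ smallTraces A P := (Finset.mem_filter.1 hmem).2.2
    rcases mem_smallTraces.1 htr with h | ⟨w, -, hw⟩ | h
    · rw [h] at hc; simp at hc
    · rw [← hw] at hc; simp at hc
    · rwa [Finset.eq_of_subset_of_card_le hsub (by rw [hP _ h, Finset.card_pair hne])]
  rcases hPk with ⟨rfl, hk⟩ | ⟨hPc, hk⟩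
  · have := exists_injOn_pairs (j := k) (a := A.card) hinj (fun i hi _ => by
      by_contra! h
      exact absurd (hbad i hi h.1 h.2) (Finset.notMem_empty _)) (Or.inl ⟨le_rfl, hk⟩)
    omega
  · have hj : ∃ j, ∀ i < k, i ≠ j → v i ∈ A ∨ v (i + 1) ∈ A := by
      by_cases hex : ∃ j < k, v j ∉ A ∧ v (j + 1) ∉ A
      · obtain ⟨j, hjk, hj⟩ := hex
        refine ⟨j, fun i hi hij => ?_⟩
        by_contra! h
        have heq := Finset.card_le_one.1 hPc _ (hbad i hi h.1 h.2) _ (hbad j hjk hj.1 hj.2)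
        have h1 : v i ∈ ({v j, v (j + 1)} : Finset V) := heq ▸ by simp
        have h2 : v (i + 1) ∈ ({v j, v (j + 1)} : Finset V) := heq ▸ by simp
        rw [Finset.mem_insert, Finset.mem_singleton] at h1 h2
        have hi0 := Set.mem_Iic.2 hi.le
        have hi1 : i + 1 ∈ Set.Iic k := Set.mem_Iic.2 hi
        have hj0 := Set.mem_Iic.2 hjk.le
        have hj1 : j + 1 ∈ Set.Iic k := Set.mem_Iic.2 hjk
        rcases h1 with h1 | h1
        · exact hij (hinj hi0 hj0 h1)
        · have h3 := hinj hi0 hj1 h1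
          rcases h2 with h2 | h2
          · have := hinj hi1 hj0 h2
            omega
          · have := hinj hi1 hj1 h2
            omega
      · push Not at hex
        exact ⟨k, fun i hi _ => or_iff_not_imp_left.2 (hex i hi)⟩
    obtain ⟨j, hj⟩ := hj
    have := exists_injOn_pairs (a := A.card) hinj hj (Or.inr hk)
    omega

theorem exists_extremal (hr : 2 ≤ r) (hk : 2 * r + 1 ≤ k) (hV : (k - 1) / 2 + 2 ≤ Fintype.card V) :
    ∃ H : Finset (Finset V), (∀ e ∈ H, e.card = r) ∧ HConnected H ∧ IsEmpty (BergePath H k) ∧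
      H.card = extremalCount r k (Fintype.card V) := by
  obtain ⟨A, -, hA⟩ := Finset.exists_subset_card_eq (s := (Finset.univ : Finset V))
    (n := (k - 1) / 2) (by rw [Finset.card_univ]; omega)
  have hP : ∃ P : Finset (Finset V), (∀ K ∈ P, Disjoint K A ∧ K.card = 2) ∧
      P.card = if 2 ∣ k then 1 else 0 := by
    split_ifs with h
    · obtain ⟨K, hK, hKc⟩ := Finset.exists_subset_card_eq (s := Finset.univ \ A) (n := 2)
        (by rw [Finset.card_sdiff_of_subset (Finset.subset_univ A), Finset.card_univ]; omega)
      refine ⟨{K}, ?_, by simp⟩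
      intro K' hK'
      obtain rfl := Finset.mem_singleton.1 hK'
      exact ⟨Finset.disjoint_of_subset_left hK Finset.sdiff_disjoint, hKc⟩
    · exact ⟨∅, by simp, by simp⟩
  obtain ⟨P, hP, hPc⟩ := hP
  refine ⟨traceFamily r A (smallTraces A P), fun e he => (Finset.mem_filter.1 he).2.1,
    hConnected_traceFamily hr (by omega) P,
    isEmpty_bergePath_traceFamily (fun K hK => (hP K hK).2) ?_, ?_⟩
  · split_ifs at hPc with h
    · exact Or.inr ⟨hPc.le, by omega⟩
    · exact Or.inl ⟨Finset.card_eq_zero.1 hPc, by omega⟩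
  · rw [card_traceFamily_smallTraces hr hP, hPc, extremalCount, hA]
    split_ifs <;> simp

end LowerBound

/-- For all integers `r`, `k` with `k ≥ 2r+13 ≥ 18` there exists `N_{k,r}`
such that for all `n > N_{k,r}` the maximum number of hyperedges of a connected `n`-vertex
`r`-uniform hypergraph with no Berge-path of length `k` equals
`C(⌊(k-1)/2⌋, r-1)·(n − ⌊(k-1)/2⌋) + C(⌊(k-1)/2⌋, r) + [2∣k]·C(⌊(k-1)/2⌋, r-2)`. -/
theorem extremal_number_connected_berge_path_free
    (r k : ℕ) (hk : 2 * r + 13 ≤ k) (hr : 18 ≤ 2 * r + 13) :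
    ∃ N : ℕ, ∀ n : ℕ, N < n →
      IsGreatest {m : ℕ | ∃ H : Finset (Finset (Fin n)),
          (∀ e ∈ H, e.card = r) ∧ HConnected H ∧ IsEmpty (BergePath H k) ∧ H.card = m}
        (extremalCount r k n) := by
  obtain ⟨a, ha⟩ : ∃ a, a = (k - 1) / 2 := ⟨_, rfl⟩
  obtain ⟨b, hb⟩ : ∃ b, b = 2 * k + r * (2 * k) + a := ⟨_, rfl⟩
  obtain ⟨M, hM⟩ : ∃ M, M = r * (k + 1) + 1 := ⟨_, rfl⟩
  obtain ⟨B, hB⟩ : ∃ B, B = 2 ^ M * (M + b + 2) := ⟨_, rfl⟩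
  refine ⟨2 * a.choose (r - 1) * a + B * excessBound B M k + a + 2, fun n hn => ?_⟩
  have hcard : Fintype.card (Fin n) = n := Fintype.card_fin n
  constructor
  · obtain ⟨H, hu, hH, hP, hc⟩ := exists_extremal (V := Fin n) (r := r) (k := k) (by omega)
      (by omega) (by omega)
    exact ⟨H, hu, hH, hP, by rw [hc, hcard]⟩
  · rintro m ⟨H, hu, hH, hP, rfl⟩
    by_contra! hlt
    have hge : a.choose (r - 1) * (n - a) ≤ H.card := by
      rw [extremalCount, ← ha] at hlt
      omega
    have hbig : (B * excessBound B M k + 1 : ℕ) +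
        (2 * a.choose (r - 1) - 1) * (Fintype.card (Fin n) : ℤ) ≤ 2 * H.card := by
      rw [hcard]
      zify [show a ≤ n by omega] at hge hn
      push_cast
      linarith
    obtain ⟨A, W, hA, hW, hcore⟩ := exists_core (by omega) (by omega) hu hH hP (by omega) hM.ge
      hB.ge (⟨0, by omega⟩ : Fin n) hbig
    have := hcore.card_le_extremalCount (by omega) hk (hA.trans ha) hu hH hP (by omega)
    rw [hcard] at this
    omega
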